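/- Let Γ ≤ Sim_L(ℝ^{m+2}) act freely, properly discontinuously and cocompactly on ℝ^{m+2} (so that ℝ^{m+2}/Γ is a compact complete Lorentzian similarity manifold). Then Γ contains a nontrivial pure translation, i.e. an element γ ≠ 1 of the form γ(x) = x + a with a ∈ ℝ^{m+2}, a ≠ 0. -/

import Mathlib

noncomputable section

/-- `Vec n` is the euclidean space `ℝ^n`. -/
abbrev Vec (n : ℕ) : Type := Fin n → ℝ

/-- The group of invertible affine transformations of `ℝ^n`. -/
abbrev AffGroup (n : ℕ) := Vec n ≃ᵃ[ℝ] Vec n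

/-- The standard Lorentz quadratic form `Q(x) = x₁² + ⋯ + x_{m+1}² − x_{m+2}²` on `ℝ^{m+2}`. -/
def lorentzQ (m : ℕ) (x : Vec (m + 2)) : ℝ :=
  (∑ i : Fin (m + 1), x i.castSucc ^ 2) - x (Fin.last (m + 1)) ^ 2

/-- Membership in the Lorentzian similarity group
`Sim_L(ℝ^{m+2}) = ℝ^{m+2} ⋊ (O(m+1,1) × ℝ^+)`: the linear part is `λ • A` with `λ > 0`
and `A` a linear map preserving the Lorentz form. -/
def InSimL (m : ℕ) (g : AffGroup (m + 2)) : Prop :=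
  ∃ (lam : ℝ) (A : Vec (m + 2) →ₗ[ℝ] Vec (m + 2)), 0 < lam ∧
    (∀ v, lorentzQ m (A v) = lorentzQ m v) ∧ ∀ v, g.linear v = lam • A v

/-- Properly discontinuous action on `ℝ^n`. -/
def ProperlyDisc {n : ℕ} (Γ : Subgroup (AffGroup n)) : Prop :=
  ∀ K : Set (Vec n), IsCompact K →
    {γ : AffGroup n | γ ∈ Γ ∧ (⇑γ '' K ∩ K).Nonempty}.Finite

/-- Free action on `ℝ^n`. -/
def FreeAction {n : ℕ} (Γ : Subgroup (AffGroup n)) : Prop :=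
  ∀ γ ∈ Γ, (∃ x : Vec n, γ x = x) → γ = 1

/-- Cocompact action on `ℝ^n`: some compact set meets every orbit. -/
def CocompactAction {n : ℕ} (Γ : Subgroup (AffGroup n)) : Prop :=
  ∃ K : Set (Vec n), IsCompact K ∧ ∀ x : Vec n, ∃ γ ∈ Γ, γ x ∈ K


section NoRetraction

open MeasureTheory Metric Polynomial

/-- `det (1 + t M)` at `t = 1` is a fixed linear combination of its values at other nodes. -/
lemma exists_nodes_det {E : Type*} [NormedAddCommGroup E] [NormedSpace ℝ E]
    [FiniteDimensional ℝ E] (ε : ℝ) (hε : 0 < ε) :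
    ∃ (k : ℕ) (t l : Fin k → ℝ), (∀ i, 0 < t i ∧ t i ≤ ε) ∧ (∑ i, l i = 1) ∧
      ∀ M : E →L[ℝ] E, (ContinuousLinearMap.id ℝ E + M).det =
        ∑ i, l i * (ContinuousLinearMap.id ℝ E + t i • M).det := by
  set d := Module.finrank ℝ E with hd
  let b := Module.finBasis ℝ E
  have key : ∀ (M : E →L[ℝ] E), ∃ p : ℝ[X], p.natDegree ≤ d ∧
      ∀ s : ℝ, p.eval s = (ContinuousLinearMap.id ℝ E + s • M).det := by
    intro M
    let A := LinearMap.toMatrix b b (M : E →ₗ[ℝ] E)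
    refine ⟨Matrix.det ((X : ℝ[X]) • A.map C + (1 : Matrix _ _ ℝ).map C), ?_, ?_⟩
    · have := natDegree_det_X_add_C_le A 1
      simpa using this
    · intro s
      have h1 : (ContinuousLinearMap.id ℝ E + s • M).det = (1 + s • A).det := by
        rw [ContinuousLinearMap.det, ← LinearMap.det_toMatrix b]
        congr 1
        simp only [ContinuousLinearMap.toLinearMap_add, ContinuousLinearMap.toLinearMap_smul, map_add, map_smul,
          ContinuousLinearMap.coe_id, LinearMap.toMatrix_id, A]
      rw [h1, ← coe_evalRingHom, RingHom.map_det]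
      congr 1
      ext i j
      simp only [RingHom.mapMatrix_apply, Matrix.map_apply, Matrix.add_apply, Matrix.smul_apply,
        smul_eq_mul, coe_evalRingHom, eval_add, eval_mul, eval_X, eval_C]
      ring
  let t : Fin (d + 1) → ℝ := fun i => ε / ((i : ℝ) + 1)
  have tinj : Function.Injective t := by
    intro i j hij
    have hi : ((i : ℝ) + 1) ≠ 0 := by positivity
    have hj : ((j : ℝ) + 1) ≠ 0 := by positivity
    have : ε * ((j : ℝ) + 1) = ε * ((i : ℝ) + 1) := by
      have := hij
      simp only [t] at this
      field_simp at this
      rw [this]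
    have := mul_left_cancel₀ hε.ne' this
    have h2 : (j : ℝ) = i := by linarith
    exact Fin.ext (by exact_mod_cast h2.symm)
  have hvs : Set.InjOn t (Finset.univ : Finset (Fin (d + 1))) := tinj.injOn
  refine ⟨d + 1, t, fun i => (Lagrange.basis Finset.univ t i).eval 1, ?_, ?_, ?_⟩
  · intro i
    refine ⟨by positivity, ?_⟩
    apply div_le_self hε.le
    have : (0 : ℝ) ≤ i := by positivity
    linarith
  · have := Lagrange.sum_basis hvs ⟨0, Finset.mem_univ _⟩
    rw [← eval_finsetSum, this, eval_one]
  · intro M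
    obtain ⟨p, hp, hpe⟩ := key M
    have h1 := hpe 1
    rw [one_smul] at h1
    rw [← h1]
    have hdeg : p.degree < (Finset.univ : Finset (Fin (d + 1))).card := by
      rw [Finset.card_univ, Fintype.card_fin]
      exact lt_of_le_of_lt degree_le_natDegree (by exact_mod_cast Nat.lt_succ_of_le hp)
    have h3 := Lagrange.eq_interpolate hvs hdeg
    conv_lhs => rw [h3]
    rw [Lagrange.interpolate_apply, eval_finsetSum]
    refine Finset.sum_congr rfl fun i _ => ?_
    rw [eval_mul, eval_C, hpe, mul_comm]

lemma det_id_add_pos {E : Type*} [NormedAddCommGroup E] [NormedSpace ℝ E]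
    [FiniteDimensional ℝ E] (M : E →L[ℝ] E) (hM : ‖M‖ < 1) :
    0 < (ContinuousLinearMap.id ℝ E + M).det := by
  by_contra hneg
  push Not at hneg
  let F : ℝ → ℝ := fun s => (ContinuousLinearMap.id ℝ E + s • M).det
  have hF : Continuous F := by
    apply ContinuousLinearMap.continuous_det.comp
    fun_prop
  have h0 : F 0 = 1 := by simp [F, ContinuousLinearMap.det]
  have h1 : F 1 ≤ 0 := by simpa [F] using hneg
  obtain ⟨s, hs, hs0⟩ := intermediate_value_Icc' (zero_le_one) hF.continuousOn
    (show (0 : ℝ) ∈ Set.Icc (F 1) (F 0) from ⟨h1, by rw [h0]; exact zero_le_one⟩)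
  have hinj : Function.Injective (ContinuousLinearMap.id ℝ E + s • M) := by
    rw [injective_iff_map_eq_zero]
    intro x hx
    have h2 : x = -(s • M x) := by
      have : x + s • M x = 0 := hx
      exact eq_neg_of_add_eq_zero_left this
    by_contra hx0
    have hxp : 0 < ‖x‖ := norm_pos_iff.2 hx0
    have h3 : ‖x‖ ≤ ‖M‖ * ‖x‖ := by
      calc ‖x‖ = ‖s • M x‖ := by conv_lhs => rw [h2, norm_neg]
        _ = |s| * ‖M x‖ := by rw [norm_smul, Real.norm_eq_abs]
        _ ≤ 1 * ‖M x‖ := by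
            gcongr
            rw [abs_of_nonneg hs.1]; exact hs.2
        _ ≤ ‖M‖ * ‖x‖ := by rw [one_mul]; exact M.le_opNorm x
    nlinarith
  have : (ContinuousLinearMap.id ℝ E + s • M).det ≠ 0 := by
    have hk : LinearMap.ker ((ContinuousLinearMap.id ℝ E + s • M : E →L[ℝ] E) : E →ₗ[ℝ] E) = ⊥ :=
      LinearMap.ker_eq_bot.2 hinj
    rw [ContinuousLinearMap.det]
    intro h
    exact (LinearMap.bot_lt_ker_of_det_eq_zero h).ne' hk
  exact this hs0

theorem no_C1_retraction {E : Type*} [NormedAddCommGroup E] [NormedSpace ℝ E]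
    [FiniteDimensional ℝ E] (r : E → E)
    (hr : ContDiff ℝ 1 r) (R : ℝ) (hR : 0 < R) (hs : ∀ x, ‖x‖ = R → r x = x)
    (hdet : ∀ x, (fderiv ℝ r x).det = 0) : False := by
  borelize E
  let μ : Measure E := Measure.addHaar
  have : ProperSpace E := FiniteDimensional.proper ℝ E
  have hrd : Differentiable ℝ r := hr.differentiable (by norm_num)
  let h : E → E := fun x => r x - x
  have hh : ∀ x, HasFDerivAt h (fderiv ℝ r x - ContinuousLinearMap.id ℝ E) x := fun x =>
    (hrd x).hasFDerivAt.sub (hasFDerivAt_id x)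
  have hcont : Continuous fun x => fderiv ℝ r x - ContinuousLinearMap.id ℝ E :=
    (hr.continuous_fderiv (by norm_num)).sub continuous_const
  obtain ⟨C, hC⟩ := (isCompact_closedBall (0 : E) R).exists_bound_of_continuousOn hcont.continuousOn
  have hC0 : 0 ≤ C := (norm_nonneg _).trans (hC 0 (by simp [hR.le]))
  have hlip : ∀ x ∈ closedBall (0 : E) R, ∀ y ∈ closedBall (0 : E) R,
      ‖h x - h y‖ ≤ C * ‖x - y‖ := by
    intro x hx y hy
    exact Convex.norm_image_sub_le_of_norm_hasFDerivWithin_le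
      (fun z _ => (hh z).hasFDerivWithinAt) hC (convex_closedBall 0 R) hy hx
  have hsph : ∀ x : E, ‖x‖ = R → h x = 0 := fun x hx => by simp [h, hs x hx]
  classical
  let g : E → E := fun x => if ‖x‖ ≤ R then h x else 0
  have gin : ∀ x, ‖x‖ ≤ R → g x = h x := fun x hx => if_pos hx
  have gout : ∀ x, R ≤ ‖x‖ → g x = 0 := by
    intro x hx
    rcases hx.eq_or_lt with h1 | h1
    · rw [gin x h1.symm.le, hsph x h1.symm]
    · exact if_neg (not_le.2 h1)
  have mix : ∀ x y, ‖x‖ ≤ R → R ≤ ‖y‖ → ‖g x - g y‖ ≤ C * ‖x - y‖ := by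
    intro x y hx hy
    let c : ℝ → E := fun s => x + s • (y - x)
    have hc : Continuous fun s => ‖c s‖ := by fun_prop
    obtain ⟨s, hs1, hs2⟩ := intermediate_value_Icc (zero_le_one) hc.continuousOn
      (show R ∈ Set.Icc (‖c 0‖) (‖c 1‖) by simpa [c] using ⟨hx, hy⟩)
    have hs2 : ‖c s‖ = R := hs2
    have h1 := hlip x (by simpa using hx) (c s) (by simp [hs2])
    rw [hsph _ hs2] at h1
    rw [gin x hx, gout y hy]
    refine h1.trans ?_
    gcongr
    have : x - c s = s • (x - y) := by simp only [c]; module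
    rw [this, norm_smul, Real.norm_eq_abs, abs_of_nonneg hs1.1]
    exact mul_le_of_le_one_left (norm_nonneg _) hs1.2
  have glip : ∀ x y, ‖g x - g y‖ ≤ C * ‖x - y‖ := by
    intro x y
    rcases le_total ‖x‖ R with hx | hx <;> rcases le_total ‖y‖ R with hy | hy
    · rw [gin x hx, gin y hy]
      exact hlip x (by simpa using hx) y (by simpa using hy)
    · exact mix x y hx hy
    · rw [norm_sub_rev, norm_sub_rev x]; exact mix y x hy hx
    · rw [gout x hx, gout y hy]; simp; positivity
  let ε : ℝ := 1 / (2 * (C + 1))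
  have hε : 0 < ε := by positivity
  have hεC : ε * C < 1 := by
    have : ε * (2 * (C + 1)) = 1 := by simp only [ε]; field_simp
    nlinarith
  have main : ∀ t : ℝ, 0 < t → t ≤ ε →
      ∫ x in ball (0 : E) R, (ContinuousLinearMap.id ℝ E +
        t • (fderiv ℝ r x - ContinuousLinearMap.id ℝ E)).det ∂μ = (μ (ball (0 : E) R)).toReal := by
    intro t ht hte
    have htC : t * C < 1 := lt_of_le_of_lt (by gcongr) hεC
    let Φ : E → E := fun x => x + t • g x
    let c : NNReal := ⟨t * C, by positivity⟩
    have happ : ApproximatesLinearOn Φ ((ContinuousLinearEquiv.refl ℝ E : E ≃L[ℝ] E) : E →L[ℝ] E)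
        Set.univ c := by
      intro x _ y _
      have : Φ x - Φ y - ((ContinuousLinearEquiv.refl ℝ E : E ≃L[ℝ] E) : E →L[ℝ] E) (x - y)
          = t • (g x - g y) := by
        simp only [Φ, ContinuousLinearEquiv.coe_refl, ContinuousLinearMap.coe_id', id]
        module
      rw [this, norm_smul, Real.norm_eq_abs, abs_of_pos ht]
      calc t * ‖g x - g y‖ ≤ t * (C * ‖x - y‖) := by gcongr; exact glip x y
        _ = (c : ℝ) * ‖x - y‖ := by
            show t * (C * ‖x - y‖) = (t * C) * ‖x - y‖
            ring
    have hc : Subsingleton E ∨ c < ‖((ContinuousLinearEquiv.refl ℝ E).symm : E →L[ℝ] E)‖₊⁻¹ := by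
      rcases subsingleton_or_nontrivial E with hE | hE
      · exact Or.inl hE
      · right
        have : ‖((ContinuousLinearEquiv.refl ℝ E).symm : E →L[ℝ] E)‖₊ = 1 := by
          ext
          simp
        rw [this, inv_one]
        exact htC
    have hinj : Function.Injective Φ := by
      have := happ.injOn hc
      exact Set.injOn_univ.1 this
    have hsurj : Function.Surjective Φ := happ.surjective hc
    have hΦout : ∀ x, R ≤ ‖x‖ → Φ x = x := fun x hx => by simp [Φ, gout x hx]
    have himg : Φ '' ball (0 : E) R = ball (0 : E) R := by
      ext y
      constructor
      · rintro ⟨x, hx, rfl⟩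
        by_contra hy
        have hy' : R ≤ ‖Φ x‖ := by simpa using hy
        have := hinj (hΦout _ hy')
        rw [this] at hy'
        have hx' : ‖x‖ < R := by simpa using hx
        linarith
      · intro hy
        obtain ⟨x, rfl⟩ := hsurj y
        refine ⟨x, ?_, rfl⟩
        by_contra hx
        have hx' : R ≤ ‖x‖ := by simpa using hx
        rw [hΦout x hx'] at hy
        exact hx hy
    have hder : ∀ x ∈ ball (0 : E) R, HasFDerivWithinAt Φ (ContinuousLinearMap.id ℝ E +
        t • (fderiv ℝ r x - ContinuousLinearMap.id ℝ E)) (ball (0 : E) R) x := by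
      intro x hx
      have h1 : HasFDerivAt (fun y => y + t • h y) (ContinuousLinearMap.id ℝ E +
        t • (fderiv ℝ r x - ContinuousLinearMap.id ℝ E)) x :=
        (hasFDerivAt_id x).add ((hh x).const_smul t)
      refine h1.hasFDerivWithinAt.congr (fun y hy => ?_) ?_
      · have : ‖y‖ ≤ R := by have : ‖y‖ < R := by simpa using hy
                             exact this.le
        simp [Φ, gin y this]
      · have : ‖x‖ ≤ R := by have : ‖x‖ < R := by simpa using hx
                             exact this.le
        simp [Φ, gin x this]
    have := integral_image_eq_integral_abs_det_fderiv_smul μ measurableSet_ball hder hinj.injOn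
      (fun _ => (1 : ℝ))
    rw [himg] at this
    simp only [smul_eq_mul, mul_one] at this
    have h2 : ∫ x in ball (0 : E) R, (1 : ℝ) ∂μ = (μ (ball (0 : E) R)).toReal := by
      simp [Measure.real]
    rw [← h2, this]
    refine setIntegral_congr_fun measurableSet_ball fun x hx => ?_
    have hx' : x ∈ closedBall (0 : E) R := ball_subset_closedBall hx
    have hpos := det_id_add_pos (t • (fderiv ℝ r x - ContinuousLinearMap.id ℝ E)) (by
      rw [norm_smul, Real.norm_eq_abs, abs_of_pos ht]
      exact lt_of_le_of_lt (by gcongr; exact hC x hx') htC)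
    exact (abs_of_pos hpos).symm
  obtain ⟨k, t, l, ht, hl, hdetl⟩ := exists_nodes_det (E := E) ε hε
  have hint : ∀ i, IntegrableOn (fun x => (ContinuousLinearMap.id ℝ E +
        t i • (fderiv ℝ r x - ContinuousLinearMap.id ℝ E)).det) (ball (0 : E) R) μ := by
    intro i
    have hcd : Continuous fun x => (ContinuousLinearMap.id ℝ E +
        t i • (fderiv ℝ r x - ContinuousLinearMap.id ℝ E)).det := by
      apply ContinuousLinearMap.continuous_det.comp
      exact continuous_const.add (hcont.const_smul (t i))
    exact (hcd.continuousOn.integrableOn_compact (isCompact_closedBall (0 : E) R)).mono_set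
      ball_subset_closedBall
  have hz : ∫ x in ball (0 : E) R, (0 : ℝ) ∂μ = (μ (ball (0 : E) R)).toReal := by
    calc ∫ x in ball (0 : E) R, (0 : ℝ) ∂μ
        = ∫ x in ball (0 : E) R, ∑ i, l i * (ContinuousLinearMap.id ℝ E +
        t i • (fderiv ℝ r x - ContinuousLinearMap.id ℝ E)).det ∂μ := by
          refine setIntegral_congr_fun measurableSet_ball fun x _ => ?_
          have := hdetl (fderiv ℝ r x - ContinuousLinearMap.id ℝ E)
          simp only [← this, add_sub_cancel, hdet x]
      _ = ∑ i, l i * ∫ x in ball (0 : E) R, (ContinuousLinearMap.id ℝ E +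
        t i • (fderiv ℝ r x - ContinuousLinearMap.id ℝ E)).det ∂μ := by
          rw [integral_finsetSum _ fun i _ => (hint i).const_mul _]
          simp_rw [integral_const_mul]
      _ = ∑ i, l i * (μ (ball (0 : E) R)).toReal := by
          refine Finset.sum_congr rfl fun i _ => ?_
          rw [main (t i) (ht i).1 (ht i).2]
      _ = (μ (ball (0 : E) R)).toReal := by rw [← Finset.sum_mul, hl, one_mul]
  rw [integral_zero] at hz
  have hpos : 0 < (μ (ball (0 : E) R)).toReal :=
    ENNReal.toReal_pos (measure_ball_pos μ 0 hR).ne' measure_ball_lt_top.ne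
  linarith

end NoRetraction


section KL

open Metric Topology

lemma surj_of_id_outside {E : Type*} [NormedAddCommGroup E] [InnerProductSpace ℝ E]
    [FiniteDimensional ℝ E] (G : E → E) (hG : ContDiff ℝ 1 G) (R0 : ℝ)
    (h : ∀ x, R0 ≤ ‖x‖ → G x = x) : Function.Surjective G := by
  intro p
  by_contra hp
  push Not at hp
  let u : E → E := fun x => G (x + p) - p
  have hu0 : ∀ x, u x ≠ 0 := fun x => sub_ne_zero.2 (hp _)
  have hu : ContDiff ℝ 1 u := by
    apply ContDiff.sub _ contDiff_const
    exact hG.comp (contDiff_id.add contDiff_const)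
  set R : ℝ := |R0| + ‖p‖ + 1 with hRdef
  have hR : 0 < R := by positivity
  have hur : ∀ x, ‖x‖ = R → u x = x := by
    intro x hx
    have : R0 ≤ ‖x + p‖ := by
      have h1 : ‖x‖ ≤ ‖x + p‖ + ‖p‖ := by
        calc ‖x‖ = ‖(x + p) - p‖ := by rw [add_sub_cancel_right]
          _ ≤ _ := norm_sub_le _ _
      have := le_abs_self R0
      linarith
    simp [u, h _ this]
  let r : E → E := fun x => (R / ‖u x‖) • u x
  have hrc : ContDiff ℝ 1 r :=
    (contDiff_const.div (hu.norm ℝ hu0) (fun x => norm_ne_zero_iff.2 (hu0 x))).smul hu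
  have hrn : ∀ x, inner ℝ (r x) (r x) = R ^ 2 := by
    intro x
    rw [real_inner_self_eq_norm_sq]
    simp only [r]
    rw [norm_smul, norm_div, norm_norm, div_mul_cancel₀ _ (norm_ne_zero_iff.2 (hu0 x)), Real.norm_eq_abs,
      sq_abs]
  refine no_C1_retraction r hrc R hR ?_ ?_
  · intro x hx
    simp only [r]
    rw [hur x hx, hx, div_self hR.ne', one_smul]
  · intro x
    by_contra hdet
    have hd := (hrc.differentiable (by norm_num) x).hasFDerivAt
    have h1 := hd.inner ℝ hd
    have h2 : (fun x => inner ℝ (r x) (r x)) = fun _ => R ^ 2 := funext hrn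
    rw [h2] at h1
    have h3 := h1.unique (hasFDerivAt_const _ _)
    have h4 : ∀ v, inner ℝ (r x) (fderiv ℝ r x v) = 0 := by
      intro v
      have := DFunLike.congr_fun h3 v
      simp [real_inner_comm] at this
      exact this
    have hsurj : Function.Surjective ((fderiv ℝ r x : E →L[ℝ] E) : E →ₗ[ℝ] E) := by
      have : IsUnit (LinearMap.det ((fderiv ℝ r x : E →L[ℝ] E) : E →ₗ[ℝ] E)) :=
        isUnit_iff_ne_zero.2 hdet
      have := (LinearMap.isUnit_iff_isUnit_det _).2 this
      exact ((Module.End.isUnit_iff _).1 this).2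
    obtain ⟨v, hv⟩ := hsurj (r x)
    have h5 := h4 v
    have hv' : fderiv ℝ r x v = r x := hv
    rw [hv', hrn x] at h5
    have : 0 < R ^ 2 := by positivity
    linarith

lemma surj_of_id_off_compact {E : Type*} [NormedAddCommGroup E] [NormedSpace ℝ E]
    [FiniteDimensional ℝ E] (G : E → E) (hG : ContDiff ℝ 1 G) (K : Set E) (hK : IsCompact K)
    (h : ∀ x, x ∉ K → G x = x) : Function.Surjective G := by
  let e := toEuclidean (E := E)
  obtain ⟨R0, hR0⟩ := (hK.image e.continuous).isBounded.exists_norm_le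
  have := surj_of_id_outside (fun x => e (G (e.symm x)))
    (e.contDiff.comp (hG.comp e.symm.contDiff)) (R0 + 1) (by
      intro x hx
      rw [h, e.apply_symm_apply]
      intro hxK
      have := hR0 x ⟨_, hxK, e.apply_symm_apply x⟩
      linarith)
  intro y
  obtain ⟨x, hx⟩ := this (e y)
  exact ⟨e.symm x, e.injective hx⟩

lemma affEquiv_continuous {n : ℕ} (g : AffGroup n) : Continuous g :=
  g.toAffineMap.continuous_of_finiteDimensional

lemma affEquiv_contDiff {n : ℕ} (g : AffGroup n) : ContDiff ℝ 1 g := by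
  have : (g : Vec n → Vec n) = fun x => g.linear x + g 0 := by
    funext x
    have := g.map_vadd 0 x
    simpa using this
  rw [this]
  exact (LinearMap.toContinuousLinearMap (g.linear : Vec n →ₗ[ℝ] Vec n)).contDiff.add contDiff_const

lemma KL {n : ℕ} (Γ : Subgroup (AffGroup n)) (hPD : ProperlyDisc Γ) (hCC : CocompactAction Γ)
    (F : Vec n → Vec n) (hF : ContDiff ℝ 1 F) (heq : ∀ γ ∈ Γ, ∀ x, F (γ x) = γ (F x)) :
    Function.Surjective F := by
  intro p
  by_contra hp
  push Not at hp
  obtain ⟨K, hK, hKc⟩ := hCC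
  let H : ℝ × Vec n → Vec n := fun q => AffineMap.lineMap q.2 (F q.2) q.1
  have hHc : Continuous H := by
    have := hF.continuous
    simp only [H, AffineMap.lineMap_apply_module]
    fun_prop
  let K1 : Set (Vec n) := H '' (Set.Icc (0 : ℝ) 1 ×ˢ K) ∪ {p}
  have hK1 : IsCompact K1 := ((isCompact_Icc.prod hK).image hHc).union isCompact_singleton
  have hT := hPD K1 hK1
  let C : Set (Vec n) := ⋃ γ ∈ {γ : AffGroup n | γ ∈ Γ ∧ (⇑γ '' K1 ∩ K1).Nonempty}, γ '' K
  have hC : IsCompact C := hT.isCompact_biUnion fun γ _ => hK.image (affEquiv_continuous γ)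
  have hoff : ∀ x, x ∉ C → ∀ t ∈ Set.Icc (0 : ℝ) 1, H (t, x) ≠ p := by
    intro x hx t ht hxp
    obtain ⟨γ, hγ, hγx⟩ := hKc x
    apply hx
    have hxg : γ⁻¹ (γ x) = x := γ.symm_apply_apply x
    simp only [C, Set.mem_iUnion]
    refine ⟨γ⁻¹, ⟨Γ.inv_mem hγ, p, ⟨H (t, γ x), Or.inl ⟨(t, γ x), ⟨ht, hγx⟩, rfl⟩, ?_⟩, Or.inr rfl⟩,
      γ x, hγx, hxg⟩
    simp only [H]
    rw [heq γ hγ, AffineEquiv.apply_lineMap, hxg]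
    rw [show γ⁻¹ (γ (F x)) = F x from γ.symm_apply_apply _]
    exact hxp
  obtain ⟨R, hR⟩ := hC.isBounded.exists_norm_le
  let χ : ContDiffBump (0 : Vec n) := ⟨|R| + 1, |R| + 2, by positivity, by linarith⟩
  have hχ1 : ∀ x ∈ C, χ x = 1 := by
    intro x hx
    apply χ.one_of_mem_closedBall
    have := hR x hx
    have := le_abs_self R
    simp only [mem_closedBall, dist_zero_right, χ]
    linarith
  have hG : ContDiff ℝ 1 fun x => H (χ x, x) := by
    simp only [H, AffineMap.lineMap_apply_module]
    have : ContDiff ℝ 1 χ := χ.contDiff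
    exact ((contDiff_const.sub this).smul contDiff_id).add (this.smul hF)
  obtain ⟨x, hx⟩ := surj_of_id_off_compact _ hG (closedBall 0 (|R| + 2)) (isCompact_closedBall _ _)
    (by
      intro x hx
      have : χ x = 0 := by
        apply χ.zero_of_le_dist
        have : |R| + 2 < dist x 0 := by simpa using hx
        exact this.le
      simp [H, this]) p
  by_cases hxC : x ∈ C
  · have hx : H (χ x, x) = p := hx
    rw [hχ1 x hxC] at hx
    simp [H] at hx
    exact hp x hx
  · exact hoff x hxC (χ x) ⟨χ.nonneg, χ.le_one⟩ hx

lemma averaging {G : Type*} [Group G] {X V : Type*} [NormedAddCommGroup X] [NormedSpace ℝ X]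
    [NormedAddCommGroup V] [NormedSpace ℝ V]
    (act : G → X → X) (hact : ∀ g h x, act (g * h) x = act g (act h x))
    (hsm : ∀ g, ContDiff ℝ 1 (act g)) (U : Set X) (φ : X → ℝ) (hφ : ContDiff ℝ 1 φ)
    (hφ0 : ∀ x, 0 ≤ φ x) (hpos : ∀ x ∈ U, ∃ g, 0 < φ (act g x))
    (hlf : ∀ x ∈ U, ∃ N ∈ 𝓝 x, {g | ∃ y ∈ N, φ (act g y) ≠ 0}.Finite)
    (ρ : G → V →ᵃ[ℝ] V) (hρ : ∀ g h v, ρ (g * h) v = ρ g (ρ h v)) (y0 : V) :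
    ∃ F : X → V, (∀ x ∈ U, ContDiffAt ℝ 1 F x) ∧ (∀ δ, ∀ x ∈ U, F (act δ x) = ρ δ (F x)) ∧
      ∀ C : Set V, Convex ℝ C → (∀ g, ρ g y0 ∈ C) → ∀ x ∈ U, F x ∈ C := by
  classical
  let F : X → V := fun x => (∑ᶠ g, φ (act g x))⁻¹ • ∑ᶠ g, φ (act g x) • ρ g⁻¹ y0
  have hfin : ∀ x ∈ U, ∃ s : Finset G, (∀ᶠ y in 𝓝 x, ∀ g, g ∉ s → φ (act g y) = 0) ∧
      0 < ∑ g ∈ s, φ (act g x) := by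
    intro x hx
    obtain ⟨N, hN, hf⟩ := hlf x hx
    have h1 : ∀ y ∈ N, ∀ g, g ∉ hf.toFinset → φ (act g y) = 0 := by
      intro y hy g hg
      by_contra hne
      exact hg (hf.mem_toFinset.2 ⟨y, hy, hne⟩)
    refine ⟨hf.toFinset, Filter.mem_of_superset hN h1, ?_⟩
    obtain ⟨g, hg⟩ := hpos x hx
    refine Finset.sum_pos' (fun _ _ => hφ0 _) ⟨g, ?_, hg⟩
    by_contra hgs
    exact hg.ne' (h1 x (mem_of_mem_nhds hN) g hgs)
  have hsum1 : ∀ (s : Finset G) y, (∀ g, g ∉ s → φ (act g y) = 0) →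
      ∑ᶠ g, φ (act g y) = ∑ g ∈ s, φ (act g y) := by
    intro s y h
    apply finsum_eq_sum_of_support_subset
    intro g hg
    by_contra hgs
    exact hg (h g hgs)
  have hsum2 : ∀ (s : Finset G) y (v : G → V), (∀ g, g ∉ s → φ (act g y) = 0) →
      ∑ᶠ g, φ (act g y) • v g = ∑ g ∈ s, φ (act g y) • v g := by
    intro s y v h
    apply finsum_eq_sum_of_support_subset
    intro g hg
    by_contra hgs
    exact hg (by simp [h g hgs])
  refine ⟨F, ?_, ?_, ?_⟩
  · intro x hx
    obtain ⟨s, hs, hp⟩ := hfin x hx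
    have h1 : F =ᶠ[𝓝 x] fun y => (∑ g ∈ s, φ (act g y))⁻¹ • ∑ g ∈ s, φ (act g y) • ρ g⁻¹ y0 := by
      filter_upwards [hs] with y hy
      simp only [F]
      rw [hsum1 s y hy, hsum2 s y _ hy]
    refine ContDiffAt.congr_of_eventuallyEq ?_ h1
    have h2 : ∀ g, ContDiffAt ℝ 1 (fun y => φ (act g y)) x := fun g => (hφ.comp (hsm g)).contDiffAt
    refine ContDiffAt.smul (ContDiffAt.inv (ContDiffAt.sum fun g _ => h2 g) hp.ne')
      (ContDiffAt.sum fun g _ => (h2 g).smul contDiffAt_const)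
  · intro δ x hx
    obtain ⟨s, hs, hp⟩ := hfin x hx
    have hs := hs.self_of_nhds
    have e1 : ∑ᶠ g, φ (act g (act δ x)) = ∑ᶠ g, φ (act g x) := by
      rw [← finsum_comp_equiv (Equiv.mulRight δ) (f := fun g => φ (act g x))]
      simp only [Equiv.coe_mulRight, hact]
    have e2 : ∑ᶠ g, φ (act g (act δ x)) • ρ g⁻¹ y0 = ∑ᶠ g, φ (act g x) • ρ δ (ρ g⁻¹ y0) := by
      rw [← finsum_comp_equiv (Equiv.mulRight δ) (f := fun g => φ (act g x) • ρ δ (ρ g⁻¹ y0))]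
      simp only [Equiv.coe_mulRight, hact, ← hρ]
      congr 1
      funext g
      congr 3
      group
    simp only [F]
    rw [e1, e2, hsum1 s x hs, hsum2 s x _ hs, hsum2 s x _ hs]
    set W := ∑ g ∈ s, φ (act g x) with hW
    have hlin : ∀ v, ρ δ v = (ρ δ).linear v + ρ δ 0 := by
      intro v
      have := (ρ δ).map_vadd 0 v
      simpa using this
    rw [hlin (W⁻¹ • _)]
    simp_rw [hlin (ρ _ y0), smul_add]
    rw [Finset.sum_add_distrib, ← Finset.sum_smul, smul_add, smul_smul, ← hW,
      inv_mul_cancel₀ hp.ne', one_smul, map_smul, map_sum]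
    simp_rw [map_smul]
  · intro C hC hg x hx
    obtain ⟨s, hs, hp⟩ := hfin x hx
    have hs := hs.self_of_nhds
    simp only [F]
    rw [hsum1 s x hs, hsum2 s x _ hs]
    exact hC.centerMass_mem (fun _ _ => hφ0 _) hp (fun g _ => hg _)

/-- Averaging over an affine properly discontinuous cocompact group. -/
lemma averaging_aff {n : ℕ} (Γ : Subgroup (AffGroup n)) (hPD : ProperlyDisc Γ)
    (hCC : CocompactAction Γ) {V : Type*} [NormedAddCommGroup V] [NormedSpace ℝ V]
    (ρ : Γ → V →ᵃ[ℝ] V) (hρ : ∀ g h v, ρ (g * h) v = ρ g (ρ h v)) (y0 : V) :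
    ∃ F : Vec n → V, ContDiff ℝ 1 F ∧ (∀ δ : Γ, ∀ x, F ((δ : AffGroup n) x) = ρ δ (F x)) ∧
      ∀ C : Set V, Convex ℝ C → (∀ g, ρ g y0 ∈ C) → ∀ x, F x ∈ C := by
  obtain ⟨K, hK, hKc⟩ := hCC
  obtain ⟨R, hR⟩ := hK.isBounded.exists_norm_le
  let χ : ContDiffBump (0 : Vec n) := ⟨|R| + 1, |R| + 2, by positivity, by linarith⟩
  have hχ1 : ∀ x ∈ K, χ x = 1 := by
    intro x hx
    apply χ.one_of_mem_closedBall
    have := hR x hx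
    have := le_abs_self R
    simp only [mem_closedBall, dist_zero_right, χ]
    linarith
  obtain ⟨F, h1, h2, h3⟩ := averaging (fun (g : Γ) (x : Vec n) => (g : AffGroup n) x)
    (fun g h x => rfl) (fun g => affEquiv_contDiff _) Set.univ χ χ.contDiff χ.nonneg'
    (by
      intro x _
      obtain ⟨γ, hγ, hγx⟩ := hKc x
      exact ⟨⟨γ, hγ⟩, by simp only; rw [hχ1 _ hγx]; exact zero_lt_one⟩)
    (by
      intro x _
      refine ⟨closedBall x 1, closedBall_mem_nhds x one_pos, ?_⟩
      have hf := hPD (closedBall x 1 ∪ closedBall 0 (|R| + 2))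
        ((isCompact_closedBall _ _).union (isCompact_closedBall _ _))
      refine Set.Finite.of_finite_image (f := Subtype.val) (hf.subset ?_) Subtype.val_injective.injOn
      rintro _ ⟨g, ⟨y, hy, hne⟩, rfl⟩
      refine ⟨g.2, _, ⟨y, Or.inl hy, rfl⟩, Or.inr ?_⟩
      by_contra hy2
      apply hne
      apply χ.zero_of_le_dist
      have : |R| + 2 < dist ((g : AffGroup n) y) 0 := by simpa using hy2
      exact this.le) ρ hρ y0
  exact ⟨F, contDiff_iff_contDiffAt.2 fun x => h1 x trivial, fun δ x => h2 δ x trivial,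
    fun C hC hg x => h3 C hC hg x trivial⟩

/-- Invariant affine subspaces are everything. -/
lemma INV {n : ℕ} (Γ : Subgroup (AffGroup n)) (hPD : ProperlyDisc Γ) (hCC : CocompactAction Γ)
    (S : Set (Vec n)) (hS : Convex ℝ S) (hne : S.Nonempty) (hinv : ∀ γ ∈ Γ, ∀ x ∈ S, γ x ∈ S) :
    S = Set.univ := by
  obtain ⟨y0, hy0⟩ := hne
  obtain ⟨F, h1, h2, h3⟩ := averaging_aff Γ hPD hCC
    (fun g => ((g : AffGroup n) : Vec n →ᵃ[ℝ] Vec n)) (fun g h v => rfl) y0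
  have hs := KL Γ hPD hCC F h1 (fun γ hγ x => h2 ⟨γ, hγ⟩ x)
  rw [Set.eq_univ_iff_forall]
  intro y
  obtain ⟨x, rfl⟩ := hs y
  exact h3 S hS (fun g => hinv _ g.2 _ hy0) x

end KL


noncomputable section Lorentz

/-- The Lorentz bilinear form. -/
def lorB (m : ℕ) : Vec (m + 2) →ₗ[ℝ] Vec (m + 2) →ₗ[ℝ] ℝ :=
  LinearMap.mk₂ ℝ (fun x y => (∑ i : Fin (m + 1), x i.castSucc * y i.castSucc)
      - x (Fin.last (m + 1)) * y (Fin.last (m + 1)))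
    (by intro x y z; simp only [Pi.add_apply, add_mul, Finset.sum_add_distrib]; ring)
    (by intro c x y; simp only [Pi.smul_apply, smul_eq_mul, mul_sub, Finset.mul_sum, mul_assoc])
    (by intro x y z; simp only [Pi.add_apply, mul_add, Finset.sum_add_distrib]; ring)
    (by intro c x y; simp only [Pi.smul_apply, smul_eq_mul, mul_sub, Finset.mul_sum]
        congr 1
        · refine Finset.sum_congr rfl fun i _ => by ring
        · ring)

lemma lorB_apply (m : ℕ) (x y : Vec (m + 2)) :
    lorB m x y = (∑ i : Fin (m + 1), x i.castSucc * y i.castSucc)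
      - x (Fin.last (m + 1)) * y (Fin.last (m + 1)) := rfl

lemma lorB_self (m : ℕ) (x : Vec (m + 2)) : lorB m x x = lorentzQ m x := by
  rw [lorB_apply, lorentzQ]
  simp only [sq]

lemma lorB_comm (m : ℕ) (x y : Vec (m + 2)) : lorB m x y = lorB m y x := by
  rw [lorB_apply, lorB_apply]
  simp only [mul_comm]

lemma lorQ_add (m : ℕ) (x y : Vec (m + 2)) :
    lorentzQ m (x + y) = lorentzQ m x + 2 * lorB m x y + lorentzQ m y := by
  rw [← lorB_self, ← lorB_self, ← lorB_self]
  simp only [map_add, LinearMap.add_apply]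
  rw [lorB_comm m y x]; ring

lemma lorQ_sub (m : ℕ) (x y : Vec (m + 2)) :
    lorentzQ m (x - y) = lorentzQ m x - 2 * lorB m x y + lorentzQ m y := by
  rw [← lorB_self, ← lorB_self, ← lorB_self]
  simp only [map_sub, LinearMap.sub_apply]
  rw [lorB_comm m y x]; ring

lemma lorQ_smul (m : ℕ) (c : ℝ) (x : Vec (m + 2)) :
    lorentzQ m (c • x) = c ^ 2 * lorentzQ m x := by
  rw [← lorB_self, ← lorB_self]
  simp only [map_smul, LinearMap.smul_apply, smul_eq_mul]
  ring

lemma lorQ_neg (m : ℕ) (x : Vec (m + 2)) : lorentzQ m (-x) = lorentzQ m x := by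
  rw [← neg_one_smul ℝ, lorQ_smul]; ring

lemma lorQ_zero (m : ℕ) : lorentzQ m 0 = 0 := by
  rw [← lorB_self]; simp

lemma lorQ_continuous (m : ℕ) : Continuous (lorentzQ m) := by
  unfold lorentzQ
  fun_prop

lemma lorB_continuous (m : ℕ) : Continuous fun p : Vec (m + 2) × Vec (m + 2) => lorB m p.1 p.2 := by
  simp only [lorB_apply]
  fun_prop

lemma lorB_polar {m : ℕ} (L : Vec (m + 2) →ₗ[ℝ] Vec (m + 2)) (c : ℝ)
    (h : ∀ v, lorentzQ m (L v) = c * lorentzQ m v) (x y : Vec (m + 2)) :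
    lorB m (L x) (L y) = c * lorB m x y := by
  have h1 := h (x + y)
  rw [map_add, lorQ_add, lorQ_add, h, h] at h1
  linarith

lemma lor_sum_zero {m : ℕ} (x : Vec (m + 2)) (h : ∑ i : Fin (m + 1), x i.castSucc ^ 2 ≤ 0)
    (h' : x (Fin.last (m + 1)) = 0) : x = 0 := by
  have h1 : ∑ i : Fin (m + 1), x i.castSucc ^ 2 = 0 :=
    le_antisymm h (Finset.sum_nonneg fun _ _ => sq_nonneg _)
  rw [Finset.sum_eq_zero_iff_of_nonneg fun _ _ => sq_nonneg _] at h1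
  funext i
  refine Fin.lastCases ?_ (fun j => ?_) i
  · exact h'
  · exact pow_eq_zero_iff (two_ne_zero) |>.1 (h1 j (Finset.mem_univ _))

lemma lorB_nondeg {m : ℕ} (x : Vec (m + 2)) (h : ∀ y, lorB m x y = 0) : x = 0 := by
  let y : Vec (m + 2) := Fin.lastCases (-(x (Fin.last _))) (fun j => x j.castSucc)
  have h1 := h y
  rw [lorB_apply] at h1
  simp only [y, Fin.lastCases_castSucc, Fin.lastCases_last] at h1
  have h2 : ∑ i : Fin (m + 1), x i.castSucc * x i.castSucc + x (Fin.last (m+1)) ^ 2 = 0 := by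
    linarith
  have h3 : 0 ≤ ∑ i : Fin (m + 1), x i.castSucc * x i.castSucc :=
    Finset.sum_nonneg fun _ _ => mul_self_nonneg _
  have h4 := sq_nonneg (x (Fin.last (m+1)))
  refine lor_sum_zero x ?_ ?_
  · simp only [sq]; linarith
  · exact pow_eq_zero_iff (two_ne_zero) |>.1 (by linarith : x (Fin.last (m+1)) ^ 2 = 0)

lemma lor_cs {m : ℕ} (x y : Vec (m + 2)) :
    (∑ i : Fin (m + 1), x i.castSucc * y i.castSucc) ^ 2 ≤
      (∑ i : Fin (m + 1), x i.castSucc ^ 2) * ∑ i : Fin (m + 1), y i.castSucc ^ 2 :=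
  Finset.sum_mul_sq_le_sq_mul_sq _ _ _

lemma lor_last_ne {m : ℕ} {x : Vec (m + 2)} (hx : lorentzQ m x ≤ 0) (hx0 : x ≠ 0) :
    x (Fin.last (m + 1)) ≠ 0 := by
  intro h
  apply hx0
  refine lor_sum_zero x ?_ h
  unfold lorentzQ at hx
  rw [h] at hx
  linarith

lemma lor_perp_timelike {m : ℕ} {τ w : Vec (m + 2)} (hτ : lorentzQ m τ < 0)
    (h : lorB m w τ = 0) : 0 ≤ lorentzQ m w ∧ (lorentzQ m w = 0 → w = 0) := by
  have hcs := lor_cs w τ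
  rw [lorB_apply] at h
  have h' : (∑ i : Fin (m + 1), w i.castSucc * τ i.castSucc) = w (Fin.last (m+1)) * τ (Fin.last (m+1)) := by
    linarith
  rw [h'] at hcs
  unfold lorentzQ at *
  have hW : 0 ≤ ∑ i : Fin (m + 1), w i.castSucc ^ 2 := Finset.sum_nonneg fun _ _ => sq_nonneg _
  have hT : 0 ≤ ∑ i : Fin (m + 1), τ i.castSucc ^ 2 := Finset.sum_nonneg fun _ _ => sq_nonneg _
  set W := ∑ i : Fin (m + 1), w i.castSucc ^ 2 with hWd
  set T := ∑ i : Fin (m + 1), τ i.castSucc ^ 2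
  set a := w (Fin.last (m+1)) with ha
  set b := τ (Fin.last (m+1))
  have hb : 0 < b ^ 2 := by linarith
  constructor
  · by_contra hneg
    push Not at hneg
    nlinarith
  · intro h0
    have : W = a ^ 2 := by linarith
    have hW0 : W ≤ 0 := by
      by_contra hp
      push Not at hp
      nlinarith
    refine lor_sum_zero w hW0 ?_
    rw [← ha]
    exact pow_eq_zero_iff (two_ne_zero) |>.1 (by linarith : a ^ 2 = 0)

lemma lor_perp_null {m : ℕ} {e w : Vec (m + 2)} (he : lorentzQ m e = 0) (he0 : e ≠ 0)
    (h : lorB m w e = 0) : 0 ≤ lorentzQ m w ∧ (lorentzQ m w = 0 → ∃ c : ℝ, w = c • e) := by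
  have hl := lor_last_ne he.le he0
  constructor
  · have hcs := lor_cs w e
    rw [lorB_apply] at h
    have h' : (∑ i : Fin (m + 1), w i.castSucc * e i.castSucc) = w (Fin.last (m+1)) * e (Fin.last (m+1)) := by
      linarith
    rw [h'] at hcs
    unfold lorentzQ at *
    have hb : 0 < e (Fin.last (m+1)) ^ 2 := by positivity
    rw [show ∑ i : Fin (m + 1), e i.castSucc ^ 2 = e (Fin.last (m+1)) ^ 2 by linarith, mul_pow] at hcs
    have := le_of_mul_le_mul_right hcs hb
    linarith
  · intro hw
    refine ⟨w (Fin.last (m+1)) / e (Fin.last (m+1)), ?_⟩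
    set c := w (Fin.last (m+1)) / e (Fin.last (m+1)) with hc
    have h1 : lorentzQ m (w - c • e) = 0 := by
      rw [lorQ_sub, lorQ_smul, map_smul, smul_eq_mul, h, he, hw]; ring
    have h2 : (w - c • e) (Fin.last (m+1)) = 0 := by
      simp only [Pi.sub_apply, Pi.smul_apply, smul_eq_mul, hc]
      field_simp
      ring
    by_contra hne
    exact lor_last_ne h1.le (sub_ne_zero.2 hne) h2

/-- The open future cone. -/
def Fut (m : ℕ) : Set (Vec (m + 2)) := {x | lorentzQ m x < 0 ∧ 0 < x (Fin.last (m + 1))}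

lemma lor_neg {m : ℕ} {x y : Vec (m + 2)} (hx : lorentzQ m x ≤ 0) (hxl : 0 < x (Fin.last (m + 1)))
    (hy : y ∈ Fut m) : lorB m x y < 0 := by
  obtain ⟨hy, hyl⟩ := hy
  have hcs := lor_cs x y
  rw [lorB_apply]
  unfold lorentzQ at *
  have hW : 0 ≤ ∑ i : Fin (m + 1), x i.castSucc ^ 2 := Finset.sum_nonneg fun _ _ => sq_nonneg _
  have hT : 0 ≤ ∑ i : Fin (m + 1), y i.castSucc ^ 2 := Finset.sum_nonneg fun _ _ => sq_nonneg _
  set W := ∑ i : Fin (m + 1), x i.castSucc ^ 2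
  set T := ∑ i : Fin (m + 1), y i.castSucc ^ 2
  set s := ∑ i : Fin (m + 1), x i.castSucc * y i.castSucc
  set a := x (Fin.last (m+1))
  set b := y (Fin.last (m+1))
  have ha2 : 0 < a ^ 2 := by positivity
  have h1 : s ^ 2 < (a * b) ^ 2 := by
    calc s ^ 2 ≤ W * T := hcs
      _ ≤ a ^ 2 * T := by gcongr; linarith
      _ < a ^ 2 * b ^ 2 := by gcongr; linarith
      _ = _ := by ring
  have := abs_lt_of_sq_lt_sq h1 (by positivity)
  linarith [le_abs_self s]

lemma lor_nonpos {m : ℕ} {x y : Vec (m + 2)} (hx : lorentzQ m x ≤ 0) (hxl : 0 < x (Fin.last (m + 1)))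
    (hy : lorentzQ m y ≤ 0) (hyl : 0 < y (Fin.last (m + 1))) : lorB m x y ≤ 0 := by
  have hcs := lor_cs x y
  rw [lorB_apply]
  unfold lorentzQ at *
  have hW : 0 ≤ ∑ i : Fin (m + 1), x i.castSucc ^ 2 := Finset.sum_nonneg fun _ _ => sq_nonneg _
  have hT : 0 ≤ ∑ i : Fin (m + 1), y i.castSucc ^ 2 := Finset.sum_nonneg fun _ _ => sq_nonneg _
  set W := ∑ i : Fin (m + 1), x i.castSucc ^ 2
  set T := ∑ i : Fin (m + 1), y i.castSucc ^ 2
  set s := ∑ i : Fin (m + 1), x i.castSucc * y i.castSucc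
  set a := x (Fin.last (m+1))
  set b := y (Fin.last (m+1))
  have h1 : s ^ 2 ≤ (a * b) ^ 2 := by
    calc s ^ 2 ≤ W * T := hcs
      _ ≤ a ^ 2 * T := by gcongr; linarith
      _ ≤ a ^ 2 * b ^ 2 := by gcongr; linarith
      _ = _ := by ring
  have := abs_le_of_sq_le_sq h1 (by positivity)
  linarith [le_abs_self s]

/-- a causal vector with negative product with a future vector is future -/
lemma lor_future {m : ℕ} {x y : Vec (m + 2)} (hx : lorentzQ m x ≤ 0) (hy : y ∈ Fut m)
    (h : lorB m x y < 0) : 0 < x (Fin.last (m + 1)) := by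
  have hx0 : x ≠ 0 := by rintro rfl; simp at h
  rcases lt_or_gt_of_ne (lor_last_ne hx hx0) with h1 | h1
  · have := lor_neg (x := -x) (by rwa [lorQ_neg]) (by simpa using h1) hy
    rw [map_neg, LinearMap.neg_apply] at this
    linarith
  · exact h1

lemma Fut_isOpen (m : ℕ) : IsOpen (Fut m) := by
  apply IsOpen.inter
  · exact isOpen_lt (lorQ_continuous m) continuous_const
  · exact isOpen_lt continuous_const (continuous_apply _)

lemma Fut_convex (m : ℕ) : Convex ℝ (Fut m) := by
  rw [convex_iff_forall_pos]
  rintro x hx y hy a b ha hb hab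
  have hB := lor_neg hx.1.le hx.2 hy
  refine ⟨?_, ?_⟩
  · rw [lorQ_add, lorQ_smul, lorQ_smul]
    simp only [map_smul, LinearMap.smul_apply, smul_eq_mul]
    have h1 : a ^ 2 * lorentzQ m x < 0 := mul_neg_of_pos_of_neg (by positivity) hx.1
    have h2 : b ^ 2 * lorentzQ m y < 0 := mul_neg_of_pos_of_neg (by positivity) hy.1
    have h3 : b * (a * lorB m x y) < 0 := by
      rw [← mul_assoc]; exact mul_neg_of_pos_of_neg (by positivity) hB
    have h4 : a * (b * lorB m x y) < 0 := by
      rw [← mul_assoc]; exact mul_neg_of_pos_of_neg (by positivity) hB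
    linarith
  · have := hx.2
    have := hy.2
    simp only [Pi.add_apply, Pi.smul_apply, smul_eq_mul]
    positivity

/-- The standard timelike vector. -/
def tvec (m : ℕ) : Vec (m + 2) := Pi.single (Fin.last (m + 1)) 1

lemma tvec_mem (m : ℕ) : tvec m ∈ Fut m := by
  have h : ∀ i : Fin (m + 1), tvec m i.castSucc = 0 := fun i => by
    simp [tvec]
  have h' : tvec m (Fin.last (m + 1)) = 1 := by simp [tvec]
  refine ⟨?_, by rw [h']; exact zero_lt_one⟩
  unfold lorentzQ
  simp [h, h']

/-- standing hypotheses, to be contradicted -/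
structure Good (m : ℕ) (Γ : Subgroup (AffGroup (m + 2))) : Prop where
  sim : ∀ γ ∈ Γ, ∃ c : ℝ, 0 < c ∧ ∀ v, lorentzQ m (γ.linear v) = c * lorentzQ m v
  fut : ∀ γ ∈ Γ, ∀ x ∈ Fut m, γ.linear x ∈ Fut m
  free : FreeAction Γ
  pd : ProperlyDisc Γ
  cc : CocompactAction Γ
  inj : ∀ γ ∈ Γ, (∀ v, γ.linear v = v) → γ = 1

lemma aff_apply {n : ℕ} (γ : AffGroup n) (x v : Vec n) : γ (x + v) = γ x + γ.linear v := by
  have := γ.map_vadd x v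
  simp only [vadd_eq_add] at this
  rw [add_comm x v, this, add_comm]

lemma aff_apply0 {n : ℕ} (γ : AffGroup n) (v : Vec n) : γ v = γ 0 + γ.linear v := by
  rw [← aff_apply, zero_add]

lemma aff_inv_linear {n : ℕ} (γ : AffGroup n) (v : Vec n) : γ.linear (γ⁻¹.linear v) = v :=
  γ.linear.apply_symm_apply v

lemma aff_inv_linear' {n : ℕ} (γ : AffGroup n) (v : Vec n) : γ⁻¹.linear (γ.linear v) = v :=
  γ.linear.symm_apply_apply v

lemma aff_mul_linear {n : ℕ} (γ δ : AffGroup n) (v : Vec n) :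
    (γ * δ).linear v = γ.linear (δ.linear v) := rfl

lemma aff_mul {n : ℕ} (γ δ : AffGroup n) (v : Vec n) : (γ * δ) v = γ (δ v) := rfl

lemma aff_inv {n : ℕ} (γ : AffGroup n) (v : Vec n) : γ (γ⁻¹ v) = v := γ.apply_symm_apply v

lemma aff_inv' {n : ℕ} (γ : AffGroup n) (v : Vec n) : γ⁻¹ (γ v) = v := γ.symm_apply_apply v

/-- existence of a fixed vector -/
lemma FP {n : ℕ} {Γ : Subgroup (AffGroup n)} (hf : FreeAction Γ) {γ : AffGroup n} (hγ : γ ∈ Γ)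
    (h1 : γ ≠ 1) : ∃ f : Vec n, f ≠ 0 ∧ γ.linear f = f := by
  by_contra hno
  push Not at hno
  let T : Vec n →ₗ[ℝ] Vec n := LinearMap.id - (γ.linear : Vec n →ₗ[ℝ] Vec n)
  have hinj : Function.Injective T := by
    rw [injective_iff_map_eq_zero]
    intro x hx
    by_contra hx0
    apply hno x hx0
    have : x - γ.linear x = 0 := hx
    exact (sub_eq_zero.1 this).symm
  obtain ⟨x, hx⟩ := LinearMap.surjective_of_injective hinj (γ 0)
  apply h1
  refine hf γ hγ ⟨x, ?_⟩
  have : x - γ.linear x = γ 0 := hx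
  rw [aff_apply0, ← this]
  abel

lemma Fut_or {m : ℕ} {x : Vec (m + 2)} (hx : lorentzQ m x < 0) : x ∈ Fut m ∨ -x ∈ Fut m := by
  have hx0 : x ≠ 0 := by rintro rfl; rw [lorQ_zero] at hx; exact lt_irrefl _ hx
  rcases lt_or_gt_of_ne (lor_last_ne hx.le hx0) with h1 | h1
  · right; exact ⟨by rwa [lorQ_neg], by simpa using h1⟩
  · left; exact ⟨hx, h1⟩

lemma not_Fut_neg {m : ℕ} {x : Vec (m + 2)} (hx : x ∈ Fut m) : -x ∉ Fut m := by
  intro h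
  have h1 := hx.2
  have h2 := h.2
  simp at h2
  linarith

/-- Step 0. -/
lemma exists_good (m : ℕ) (Γ : Subgroup (AffGroup (m + 2)))
    (hSim : ∀ γ ∈ Γ, InSimL m γ)
    (hFree : FreeAction Γ) (hPD : ProperlyDisc Γ) (hCC : CocompactAction Γ)
    (hno : ∀ γ ∈ Γ, (∀ v, γ.linear v = v) → γ = 1) :
    ∃ Γ' : Subgroup (AffGroup (m + 2)), Good m Γ' := by
  have sim : ∀ γ ∈ Γ, ∃ c : ℝ, 0 < c ∧ ∀ v, lorentzQ m (γ.linear v) = c * lorentzQ m v := by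
    intro γ hγ
    obtain ⟨lam, A, hl, hA, h⟩ := hSim γ hγ
    refine ⟨lam ^ 2, by positivity, fun v => ?_⟩
    rw [h, lorQ_smul, hA]
  have hQ : ∀ γ ∈ Γ, ∀ v, lorentzQ m v < 0 → lorentzQ m (γ.linear v) < 0 := by
    intro γ hγ v hv
    obtain ⟨c, hc, h⟩ := sim γ hγ
    rw [h]
    exact mul_neg_of_pos_of_neg hc hv
  let Γ' : Subgroup (AffGroup (m + 2)) :=
    { carrier := {γ | γ ∈ Γ ∧ ∀ x ∈ Fut m, γ.linear x ∈ Fut m}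
      one_mem' := ⟨Γ.one_mem, fun x hx => hx⟩
      mul_mem' := fun {a b} ha hb => ⟨Γ.mul_mem ha.1 hb.1, fun x hx => ha.2 _ (hb.2 x hx)⟩
      inv_mem' := fun {a} ha => ⟨Γ.inv_mem ha.1, fun x hx => by
        rcases Fut_or (hQ _ (Γ.inv_mem ha.1) x hx.1) with h | h
        · exact h
        · exfalso
          have h2 := ha.2 _ h
          rw [map_neg, aff_inv_linear] at h2
          exact not_Fut_neg hx h2⟩ }
  have hopp : ∀ γ ∈ Γ, γ ∉ Γ' → ∀ y ∈ Fut m, -γ.linear y ∈ Fut m := by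
    intro γ hγ hγ' y hy
    have : ¬ ∀ x ∈ Fut m, γ.linear x ∈ Fut m := fun h => hγ' ⟨hγ, h⟩
    push Not at this
    obtain ⟨x, hx, hx2⟩ := this
    have hx3 := (Fut_or (hQ _ hγ x hx.1)).resolve_left hx2
    refine (Fut_or (hQ _ hγ y hy.1)).resolve_left fun hy2 => ?_
    have h1 := lor_neg hx3.1.le hx3.2 hy2
    obtain ⟨c, hc, h⟩ := sim γ hγ
    have h2 := lorB_polar (γ.linear : Vec (m+2) →ₗ[ℝ] Vec (m+2)) c h x y
    have h3 := mul_neg_of_pos_of_neg hc (lor_neg hx.1.le hx.2 hy)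
    rw [map_neg, LinearMap.neg_apply] at h1
    simp only [LinearEquiv.coe_coe] at h2
    linarith
  refine ⟨Γ', ?_, fun γ hγ => hγ.2, fun γ hγ => hFree γ hγ.1, ?_, ?_, fun γ hγ => hno γ hγ.1⟩
  · exact fun γ hγ => sim γ hγ.1
  · intro K hK
    exact (hPD K hK).subset fun γ hγ => ⟨hγ.1.1, hγ.2⟩
  · by_cases hall : ∀ γ ∈ Γ, γ ∈ Γ'
    · obtain ⟨K, hK, h⟩ := hCC
      exact ⟨K, hK, fun x => (h x).imp fun γ hγ => ⟨hall γ hγ.1, hγ.2⟩⟩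
    · push Not at hall
      obtain ⟨η, hη, hη'⟩ := hall
      obtain ⟨K, hK, h⟩ := hCC
      refine ⟨K ∪ η '' K, hK.union (hK.image (affEquiv_continuous η)), fun x => ?_⟩
      obtain ⟨γ, hγ, hx⟩ := h x
      by_cases hγ' : γ ∈ Γ'
      · exact ⟨γ, hγ', Or.inl hx⟩
      · refine ⟨η * γ, ⟨Γ.mul_mem hη hγ, fun y hy => ?_⟩, Or.inr ⟨γ x, hx, rfl⟩⟩
        have := hopp η hη hη' _ (hopp γ hγ hγ' y hy)
        rw [map_neg, neg_neg] at this
        exact this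

end Lorentz


noncomputable section Step1

/-- The positive definite form attached to a timelike vector. -/
def nform (m : ℕ) (τ x : Vec (m + 2)) : ℝ := lorentzQ m x - 2 * lorB m x τ ^ 2 / lorentzQ m τ

lemma nform_pos {m : ℕ} {τ x : Vec (m + 2)} (hτ : lorentzQ m τ < 0) (hx : x ≠ 0) :
    0 < nform m τ x := by
  set q := lorentzQ m τ with hq
  set a := lorB m x τ / q with ha
  have haq : lorB m x τ = a * q := by rw [ha]; field_simp [hτ.ne]
  have hw : lorB m (x - a • τ) τ = 0 := by
    rw [map_sub, map_smul, LinearMap.sub_apply, LinearMap.smul_apply, smul_eq_mul, lorB_self, haq]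
    ring
  obtain ⟨h1, h2⟩ := lor_perp_timelike hτ hw
  have h3 : lorentzQ m (x - a • τ) = lorentzQ m x - a ^ 2 * q := by
    rw [lorQ_sub, lorQ_smul, map_smul, smul_eq_mul, haq]; ring
  have h4 : nform m τ x = lorentzQ m (x - a • τ) + a ^ 2 * (-q) := by
    rw [h3, nform, haq, ← hq]
    field_simp [hτ.ne]
    ring
  rw [h4]
  by_cases ha0 : a = 0
  · have : lorentzQ m (x - a • τ) ≠ 0 := fun h => hx (by simpa [ha0] using h2 h)
    have := lt_of_le_of_ne h1 this.symm
    rw [ha0] at *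
    linarith
  · have : 0 < a ^ 2 * (-q) := mul_pos (by positivity) (by linarith)
    linarith

lemma nform_smul {m : ℕ} (τ x : Vec (m + 2)) (c : ℝ) : nform m τ (c • x) = c ^ 2 * nform m τ x := by
  simp only [nform, lorQ_smul, map_smul, LinearMap.smul_apply, smul_eq_mul]
  ring

lemma nform_bounds {m : ℕ} (K : Set (Vec (m + 2))) (hK : IsCompact K)
    (hKQ : ∀ τ ∈ K, lorentzQ m τ < 0) :
    ∃ k C : ℝ, 0 < k ∧ 0 < C ∧ ∀ τ ∈ K, ∀ x, k * ‖x‖ ^ 2 ≤ nform m τ x ∧ nform m τ x ≤ C * ‖x‖ ^ 2 := by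
  rcases K.eq_empty_or_nonempty with rfl | hne
  · exact ⟨1, 1, one_pos, one_pos, by simp⟩
  let S : Set (Vec (m + 2) × Vec (m + 2)) := K ×ˢ Metric.sphere 0 1
  have hS : IsCompact S := hK.prod (isCompact_sphere _ _)
  have hSne : S.Nonempty := hne.prod (NormedSpace.sphere_nonempty.2 zero_le_one)
  have hcont : ContinuousOn (fun p : Vec (m + 2) × Vec (m + 2) => nform m p.1 p.2) S := by
    unfold nform
    refine ContinuousOn.sub ((lorQ_continuous m).comp continuous_snd).continuousOn ?_
    refine ContinuousOn.div ?_ ((lorQ_continuous m).comp continuous_fst).continuousOn ?_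
    · have := (lorB_continuous m).comp (continuous_swap (X := Vec (m + 2)) (Y := Vec (m + 2)))
      exact (continuous_const.mul (this.pow 2)).continuousOn
    · intro p hp
      exact (hKQ _ hp.1).ne
  obtain ⟨p, hp, hpm⟩ := hS.exists_isMinOn hSne hcont
  obtain ⟨q, hq, hqm⟩ := hS.exists_isMaxOn hSne hcont
  have hpos : ∀ r ∈ S, 0 < nform m r.1 r.2 := by
    intro r hr
    refine nform_pos (hKQ _ hr.1) ?_
    have : ‖r.2‖ = 1 := by simpa using hr.2
    intro h0
    rw [h0] at this
    simp at this
  refine ⟨nform m p.1 p.2, nform m q.1 q.2, hpos p hp, hpos q hq, fun τ hτ x => ?_⟩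
  by_cases hx : x = 0
  · subst hx
    simp [nform, lorQ_zero]
  · have hx0 : 0 < ‖x‖ := norm_pos_iff.2 hx
    have hm : (τ, ‖x‖⁻¹ • x) ∈ S := ⟨hτ, by simp [norm_smul, hx0.ne']⟩
    have h1 := hpm hm
    have h2 := hqm hm
    simp only [Set.mem_ofPred_eq, nform_smul] at h1 h2
    have e : nform m τ x = ‖x‖⁻¹ ^ 2 * nform m τ x * ‖x‖ ^ 2 := by field_simp
    constructor
    · rw [e]; gcongr
    · rw [e]; gcongr

/-- comparison of polynomial and exponential growth -/
lemma exists_poly_bound (μ : ℝ) (hμ : 1 < μ) : ∃ D : ℝ, 0 < D ∧ ∀ j : ℕ, (1 + (j : ℝ)) ^ 2 ≤ D * μ ^ j := by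
  have h := tendsto_pow_const_div_const_pow_of_one_lt 2 hμ
  obtain ⟨D, hD⟩ := h.bddAbove_range
  have hD' : ∀ j : ℕ, (j : ℝ) ^ 2 ≤ D * μ ^ j := by
    intro j
    have := hD ⟨j, rfl⟩
    simp only at this
    rwa [div_le_iff₀ (by positivity)] at this
  have hD0 : 0 ≤ D := by have := hD' 0; simpa using this
  refine ⟨2 + 2 * D, by positivity, fun j => ?_⟩
  have h1 : 1 ≤ μ ^ j := one_le_pow₀ hμ.le
  have h2 := hD' j
  nlinarith [sq_nonneg (1 - (j : ℝ))]

section core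
variable {m : ℕ} {Γ : Subgroup (AffGroup (m + 2))} {γ : AffGroup (m + 2)} {μ p0 : ℝ}
  {e f x0 : Vec (m + 2)}

lemma sim_pow (hQ : ∀ v, lorentzQ m (γ.linear v) = μ * lorentzQ m v) (i : ℕ) (v : Vec (m + 2)) :
    lorentzQ m ((γ ^ i).linear v) = μ ^ i * lorentzQ m v := by
  induction i with
  | zero => simp; rfl
  | succ i ih => rw [pow_succ', aff_mul_linear, hQ, ih]; ring

lemma b_pow (hb : ∀ v, lorB m (γ.linear v) f = μ * lorB m v f) (i : ℕ) (v : Vec (m + 2)) :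
    lorB m ((γ ^ i).linear v) f = μ ^ i * lorB m v f := by
  induction i with
  | zero => simp; rfl
  | succ i ih => rw [pow_succ', aff_mul_linear, hb, ih]; ring

lemma a_pow (ha : ∀ v, lorB m (γ.linear v) e = lorB m v e) (i : ℕ) (v : Vec (m + 2)) :
    lorB m ((γ ^ i).linear v) e = lorB m v e := by
  induction i with
  | zero => rfl
  | succ i ih => rw [pow_succ', aff_mul_linear, ha, ih]

lemma x_pow (hf : γ.linear f = f) (hx0 : γ x0 = x0 + p0 • f) (i : ℕ) :
    (γ ^ i) x0 = x0 + (i * p0) • f := by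
  induction i with
  | zero => simp
  | succ i ih =>
    rw [pow_succ', aff_mul, ih, aff_apply, hx0, map_smul, hf]
    push_cast
    module

set_option maxHeartbeats 2000000 in
/-- the case `s > 0` -/
lemma step1_pos (hG : Good m Γ) (hγ : γ ∈ Γ) (hμ : 1 < μ)
    (hQ : ∀ v, lorentzQ m (γ.linear v) = μ * lorentzQ m v)
    (hf : γ.linear f = f) (hf0 : f ≠ 0) (hQf : lorentzQ m f = 0) (hQe : lorentzQ m e = 0)
    (hef : lorB m e f = -1)
    (ha : ∀ v, lorB m (γ.linear v) e = lorB m v e)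
    (hb : ∀ v, lorB m (γ.linear v) f = μ * lorB m v f)
    (hx0 : γ x0 = x0 + p0 • f) (hp0 : p0 ≠ 0)
    {δ : AffGroup (m + 2)} (hδ : δ ∈ Γ) (hs : lorB m (δ.linear f) e < 0) :
    δ.linear f = f ∧ ∃ c : ℝ, δ x0 = x0 + c • f := by
  obtain ⟨cδ, hcδ, hQδ⟩ := hG.sim δ hδ
  set N := δ.linear with hN
  set s : ℝ := -lorB m (N f) e with hsdef
  have hs0 : 0 < s := by linarith
  set y := δ x0 - x0 with hy
  have hδx : δ x0 = x0 + y := by rw [hy]; abel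
  have hQNf : lorentzQ m (N f) = 0 := by rw [hN, hQδ, hQf, mul_zero]
  -- the commutation claim
  have hcomm : ∃ i : ℕ, 0 < i ∧ γ ^ i * δ = δ * γ ^ i := by
    obtain ⟨D, hD0, hD⟩ := exists_poly_bound μ hμ
    have hτ : lorentzQ m (e + f) = -2 := by rw [lorQ_add, hQe, hQf, hef]; ring
    obtain ⟨k0, C0, hk0, -, hbd⟩ := nform_bounds ({e + f} : Set (Vec (m + 2))) isCompact_singleton
      (by intro τ h; rw [Set.mem_singleton_iff.1 h, hτ]; norm_num)
    have hbd := fun x => (hbd (e + f) rfl x).1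
    let kk : ℕ → ℕ := fun j => ⌈(j : ℝ) / s⌉₊
    let g : ℕ → AffGroup (m + 2) := fun j => (γ ^ j)⁻¹ * δ * γ ^ (kk j)
    have hgΓ : ∀ j, g j ∈ Γ := fun j =>
      Γ.mul_mem (Γ.mul_mem (Γ.inv_mem (Γ.pow_mem hγ _)) hδ) (Γ.pow_mem hγ _)
    have hbound : ∃ R : ℝ, ∀ j, ‖g j x0 - x0‖ ≤ R := by
      set a0 := lorB m y e
      set b0 := lorB m y f
      set b1 := lorB m (N f) f
      set q0 := lorentzQ m y
      set q1 := lorB m y (N f)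
      set E1 : ℝ := |b0| + (1 / s + 1) * |p0| * |b1| with hE1
      set E2 : ℝ := |q0| + 2 * (1 / s + 1) * |p0| * |q1| + 2 * |p0| * E1 with hE2
      have hE10 : 0 ≤ E1 := by positivity
      have hE20 : 0 ≤ E2 := by positivity
      set T : ℝ := E2 * D + (|a0| + |p0| * s + E1 * D) ^ 2 with hT
      have key : ∀ j, k0 * ‖g j x0 - x0‖ ^ 2 ≤ T := by
        intro j
        set z := g j x0 - x0 with hz
        set k : ℝ := (kk j : ℝ) with hk
        have hj0 : (0 : ℝ) ≤ j := Nat.cast_nonneg j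
        have hk1 : (j : ℝ) / s ≤ k := Nat.le_ceil _
        have hk2 : k < (j : ℝ) / s + 1 := Nat.ceil_lt_add_one (by positivity)
        have hk0' : 0 ≤ k := Nat.cast_nonneg _
        have hkb : k ≤ (1 / s + 1) * (1 + j) := by
          have e1 : (1 / s + 1) * (1 + (j : ℝ)) = j / s + 1 + (1 / s + j) := by field_simp; ring
          have : 0 ≤ 1 / s + (j : ℝ) := by positivity
          linarith
        have hks : |k * s - j| ≤ s := by
          have e1 : (j : ℝ) / s * s = j := by field_simp
          rw [abs_le]
          constructor
          · nlinarith
          · nlinarith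
        have hM : (γ ^ j).linear z = y + (k * p0) • N f - (j * p0) • f := by
          have h1 : (γ ^ j) (g j x0) = δ ((γ ^ (kk j)) x0) := by
            show ((γ ^ j)) ((γ ^ j)⁻¹ (δ ((γ ^ (kk j)) x0))) = _
            rw [aff_inv]
          rw [x_pow hf hx0, aff_apply, hδx, map_smul] at h1
          have h2 : g j x0 = x0 + z := by rw [hz]; abel
          rw [h2, aff_apply, x_pow hf hx0] at h1
          have h3 := eq_sub_of_add_eq' h1
          rw [h3]
          module
        have hza : lorB m z e = a0 - k * p0 * s + j * p0 := by
          rw [← a_pow ha j z, hM]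
          simp only [map_add, map_sub, map_smul, LinearMap.add_apply, LinearMap.sub_apply,
            LinearMap.smul_apply, smul_eq_mul, hsdef]
          rw [lorB_comm m f e, hef]; ring
        have hzb : μ ^ j * lorB m z f = b0 + k * p0 * b1 := by
          rw [← b_pow hb j z, hM]
          simp only [map_add, map_sub, map_smul, LinearMap.add_apply, LinearMap.sub_apply,
            LinearMap.smul_apply, smul_eq_mul]
          rw [lorB_self, hQf]; ring
        have hzQ : μ ^ j * lorentzQ m z = q0 + 2 * k * p0 * q1 - 2 * j * p0 * (b0 + k * p0 * b1) := by
          rw [← sim_pow hQ j z, hM, lorQ_sub, lorQ_add, lorQ_smul, lorQ_smul, hQNf, hQf]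
          simp only [map_add, map_sub, map_smul, LinearMap.add_apply, LinearMap.sub_apply,
            LinearMap.smul_apply, smul_eq_mul]
          ring
        have hμj : 0 < μ ^ j := by positivity
        have hDj := hD j
        have hj1 : (1 : ℝ) + j ≤ (1 + j) ^ 2 := by nlinarith
        have hE1b : |b0 + k * p0 * b1| ≤ E1 * (1 + j) := by
          calc |b0 + k * p0 * b1| ≤ |b0| + |k * p0 * b1| := abs_add_le _ _
            _ = |b0| + k * |p0| * |b1| := by rw [abs_mul, abs_mul, abs_of_nonneg hk0']
            _ ≤ |b0| * (1 + j) + ((1 / s + 1) * (1 + j)) * |p0| * |b1| := by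
                gcongr
                exact le_mul_of_one_le_right (abs_nonneg _) (by linarith)
            _ = _ := by rw [hE1]; ring
        have hE2b : |q0 + 2 * k * p0 * q1 - 2 * j * p0 * (b0 + k * p0 * b1)| ≤ E2 * (1 + j) ^ 2 := by
          calc |q0 + 2 * k * p0 * q1 - 2 * j * p0 * (b0 + k * p0 * b1)|
              ≤ |q0| + |2 * k * p0 * q1| + |2 * j * p0 * (b0 + k * p0 * b1)| :=
                (abs_sub _ _).trans (by gcongr; exact abs_add_le _ _)
            _ = |q0| + 2 * k * |p0| * |q1| + 2 * j * |p0| * |b0 + k * p0 * b1| := by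
                simp only [abs_mul, abs_of_nonneg hk0', abs_of_nonneg hj0, abs_two]
            _ ≤ |q0| * (1 + j) ^ 2 + 2 * ((1 / s + 1) * (1 + j) ^ 2) * |p0| * |q1|
                + 2 * (1 + j) * |p0| * (E1 * (1 + j)) := by
                gcongr
                · exact le_mul_of_one_le_right (abs_nonneg _) (by nlinarith)
                · exact hkb.trans (by gcongr)
                · linarith
            _ = _ := by rw [hE2]; ring
        have hB : |lorB m z f| ≤ E1 * D := by
          have h1 : μ ^ j * |lorB m z f| ≤ μ ^ j * (E1 * D) := by
            calc μ ^ j * |lorB m z f| = |b0 + k * p0 * b1| := by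
                  rw [← hzb, abs_mul, abs_of_pos hμj]
              _ ≤ E1 * (1 + j) := hE1b
              _ ≤ E1 * (D * μ ^ j) := by gcongr; linarith
              _ = _ := by ring
          exact le_of_mul_le_mul_left h1 hμj
        have hQz : lorentzQ m z ≤ E2 * D := by
          have h1 : μ ^ j * lorentzQ m z ≤ μ ^ j * (E2 * D) := by
            calc μ ^ j * lorentzQ m z ≤ E2 * (1 + j) ^ 2 := by
                  rw [hzQ]; exact (le_abs_self _).trans hE2b
              _ ≤ E2 * (D * μ ^ j) := by gcongr
              _ = _ := by ring
          exact le_of_mul_le_mul_left h1 hμj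
        have hA : |lorB m z e| ≤ |a0| + |p0| * s := by
          rw [hza]
          calc |a0 - k * p0 * s + j * p0| = |a0 - p0 * (k * s - j)| := by ring_nf
            _ ≤ |a0| + |p0 * (k * s - j)| := abs_sub _ _
            _ = |a0| + |p0| * |k * s - j| := by rw [abs_mul]
            _ ≤ _ := by gcongr
        calc k0 * ‖z‖ ^ 2 ≤ nform m (e + f) z := hbd z
          _ = lorentzQ m z + (lorB m z e + lorB m z f) ^ 2 := by
              rw [nform, hτ, map_add]; ring
          _ ≤ E2 * D + (|a0| + |p0| * s + E1 * D) ^ 2 := by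
              gcongr ?_ + ?_
              rw [← sq_abs]
              gcongr
              exact (abs_add_le _ _).trans (by gcongr)
      refine ⟨Real.sqrt (T / k0), fun j => ?_⟩
      apply Real.le_sqrt_of_sq_le
      rw [le_div_iff₀ hk0]
      linarith [key j]
    obtain ⟨R, hR⟩ := hbound
    have hR0 : 0 ≤ R := (norm_nonneg _).trans (hR 0)
    have hfin := hG.pd (Metric.closedBall x0 R) (isCompact_closedBall _ _)
    have hmaps : Set.MapsTo g Set.univ {γ : AffGroup (m + 2) | γ ∈ Γ ∧
        (⇑γ '' Metric.closedBall x0 R ∩ Metric.closedBall x0 R).Nonempty} := by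
      intro j _
      refine ⟨hgΓ j, g j x0, ⟨x0, Metric.mem_closedBall_self hR0, rfl⟩, ?_⟩
      rw [Metric.mem_closedBall, dist_eq_norm]
      exact hR j
    obtain ⟨j, -, j', -, hjj, hgg⟩ := Set.infinite_univ.exists_lt_map_eq_of_mapsTo hmaps hfin
    have hkk : kk j ≤ kk j' := by
      apply Nat.ceil_mono
      gcongr
    obtain ⟨i, rfl⟩ := Nat.exists_eq_add_of_lt hjj
    obtain ⟨i', hi'⟩ := Nat.exists_eq_add_of_le hkk
    have hcom : γ ^ (i + 1) * δ = δ * γ ^ i' := by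
      have h1 : (γ ^ j)⁻¹ * δ * γ ^ (kk j) = (γ ^ (j + i + 1))⁻¹ * δ * γ ^ (kk (j + i + 1)) := hgg
      rw [hi', add_assoc, pow_add γ j, add_comm (kk j) i', pow_add γ i'] at h1
      have h2 : (γ ^ j)⁻¹ * δ = (γ ^ j * γ ^ (i + 1))⁻¹ * δ * γ ^ i' := by
        have := mul_right_cancel (h1.trans (mul_assoc _ _ _).symm)
        exact this
      have hc : γ ^ j * γ ^ (i + 1) = γ ^ (i + 1) * γ ^ j := pow_mul_comm _ _ _
      have h3 : δ = (γ ^ (i + 1))⁻¹ * (δ * γ ^ i') := by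
        apply mul_left_cancel (a := (γ ^ j)⁻¹)
        rw [h2, hc, mul_inv_rev]
        simp only [mul_assoc]
      exact (eq_inv_mul_iff_mul_eq.1 h3)
    have hii : i + 1 = i' := by
      have h1 := sim_pow hQ (i + 1) (δ.linear (tvec m))
      have h2 := hQδ ((γ ^ i').linear (tvec m))
      rw [← aff_mul_linear, hcom, aff_mul_linear, h2, sim_pow hQ, hQδ] at h1
      have h3 := (tvec_mem m).1
      have h4 : μ ^ i' = μ ^ (i + 1) := by
        have h5 : cδ * lorentzQ m (tvec m) ≠ 0 := mul_ne_zero hcδ.ne' h3.ne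
        apply mul_right_cancel₀ h5
        linarith
      exact (pow_right_injective₀ (by linarith) hμ.ne' h4).symm
    exact ⟨i + 1, Nat.succ_pos _, by rw [hcom, hii]⟩
  obtain ⟨i, hi, hcom⟩ := hcomm
  have hcom2 : γ ^ (2 * i) * δ = δ * γ ^ (2 * i) := by
    rw [two_mul, pow_add, mul_assoc, hcom, ← mul_assoc, hcom, mul_assoc]
  have hrel : ∀ k : ℕ, γ ^ k * δ = δ * γ ^ k →
      (γ ^ k).linear y - y = (k * p0) • (N f - f) := by
    intro k hk
    have h1 : (γ ^ k) (δ x0) = δ ((γ ^ k) x0) := by rw [← aff_mul, hk, aff_mul]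
    rw [x_pow hf hx0, hδx, aff_apply, x_pow hf hx0, aff_apply, hδx, map_smul] at h1
    have h3 := eq_sub_of_add_eq' h1
    rw [h3]
    module
  have hr1 := hrel i hcom
  have hr2 := hrel (2 * i) hcom2
  have hμi : 1 < μ ^ i := one_lt_pow₀ hμ hi.ne'
  have hip : (i : ℝ) * p0 ≠ 0 := mul_ne_zero (by exact_mod_cast hi.ne') hp0
  have hb1 : (μ ^ i - 1) * lorB m y f = i * p0 * lorB m (N f) f := by
    have := congrArg (fun v => lorB m v f) hr1
    simp only [map_sub, map_smul, LinearMap.sub_apply, LinearMap.smul_apply, smul_eq_mul,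
      b_pow hb, lorB_self, hQf] at this
    linarith
  have hb2 : (μ ^ (2 * i) - 1) * lorB m y f = 2 * (i * p0 * lorB m (N f) f) := by
    have := congrArg (fun v => lorB m v f) hr2
    simp only [map_sub, map_smul, LinearMap.sub_apply, LinearMap.smul_apply, smul_eq_mul,
      b_pow hb, lorB_self, hQf] at this
    push_cast at this
    linarith
  have hby : lorB m y f = 0 := by
    have h1 : (μ ^ i - 1) ^ 2 * lorB m y f = 0 := by
      rw [← hb1, mul_comm 2 i, pow_mul] at hb2
      linarith
    have h2 : (μ ^ i - 1) ^ 2 ≠ 0 := by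
      have : μ ^ i - 1 ≠ 0 := by linarith
      positivity
    exact (mul_eq_zero.1 h1).resolve_left h2
  have hbN : lorB m (N f) f = 0 := by
    rw [hby, mul_zero] at hb1
    exact (mul_eq_zero.1 hb1.symm).resolve_left hip
  obtain ⟨ν, hν⟩ := (lor_perp_null hQf hf0 hbN).2 hQNf
  have hν1 : ν = 1 := by
    have := congrArg (fun v => lorB m v e) hr1
    simp only [map_sub, map_smul, LinearMap.sub_apply, LinearMap.smul_apply, smul_eq_mul,
      a_pow ha, hν, lorB_comm m f e, hef, sub_self] at this
    have := (mul_eq_zero.1 this.symm).resolve_left hip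
    linarith
  rw [hν1, one_smul] at hν
  refine ⟨hν, ?_⟩
  rw [hν, sub_self, smul_zero, sub_eq_zero] at hr1
  have hQy : lorentzQ m y = 0 := by
    have := sim_pow hQ i y
    rw [hr1] at this
    have h1 : (μ ^ i - 1) * lorentzQ m y = 0 := by linarith
    exact (mul_eq_zero.1 h1).resolve_left (by linarith)
  obtain ⟨c, hc⟩ := (lor_perp_null hQf hf0 hby).2 hQy
  exact ⟨c, by rw [hδx, hc]⟩

end core

lemma step1_aux {m : ℕ} {Γ : Subgroup (AffGroup (m + 2))} (hG : Good m Γ) {γ : AffGroup (m + 2)}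
    (hγ : γ ∈ Γ) (μ : ℝ) (hμ : 1 < μ) (hQ : ∀ v, lorentzQ m (γ.linear v) = μ * lorentzQ m v) :
    False := by
  have hBp : ∀ x y, lorB m (γ.linear x) (γ.linear y) = μ * lorB m x y :=
    lorB_polar (γ.linear : Vec (m+2) →ₗ[ℝ] Vec (m+2)) μ hQ
  have hγ1 : γ ≠ 1 := by
    rintro rfl
    have h1 := hQ (tvec m)
    have h2 : lorentzQ m ((1 : AffGroup (m + 2)).linear (tvec m)) = lorentzQ m (tvec m) := rfl
    have h3 := (tvec_mem m).1
    nlinarith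
  obtain ⟨f, hf0, hf, hfl⟩ : ∃ f : Vec (m + 2), f ≠ 0 ∧ γ.linear f = f ∧ 0 < f (Fin.last (m + 1)) := by
    obtain ⟨f, hf0, hf⟩ := FP hG.free hγ hγ1
    have hQf : lorentzQ m f = 0 := by
      have := hQ f
      rw [hf] at this
      nlinarith
    rcases lt_or_gt_of_ne (lor_last_ne hQf.le hf0) with h1 | h1
    · exact ⟨-f, neg_ne_zero.2 hf0, by rw [map_neg, hf], by simpa using h1⟩
    · exact ⟨f, hf0, hf, h1⟩
  have hQf : lorentzQ m f = 0 := by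
    have := hQ f
    rw [hf] at this
    nlinarith
  have hb : ∀ v, lorB m (γ.linear v) f = μ * lorB m v f := by
    intro v
    have := hBp v f
    rwa [hf] at this
  obtain ⟨e, he0, he, hQe, hel, hef⟩ : ∃ e : Vec (m + 2), e ≠ 0 ∧ γ.linear e = μ • e ∧
      lorentzQ m e = 0 ∧ 0 < e (Fin.last (m + 1)) ∧ lorB m e f = -1 := by
    have h1 : ∃ e : Vec (m + 2), e ≠ 0 ∧ γ.linear e = μ • e := by
      by_contra hno
      push Not at hno
      let T : Vec (m + 2) →ₗ[ℝ] Vec (m + 2) := (γ.linear : Vec (m + 2) →ₗ[ℝ] Vec (m + 2)) - μ • LinearMap.id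
      have hinj : Function.Injective T := by
        rw [injective_iff_map_eq_zero]
        intro x hx
        by_contra hx0
        apply hno x hx0
        have : γ.linear x - μ • x = 0 := hx
        exact sub_eq_zero.1 this
      apply hf0
      apply lorB_nondeg
      intro y
      obtain ⟨x, rfl⟩ := LinearMap.surjective_of_injective hinj y
      show lorB m f (γ.linear x - μ • x) = 0
      rw [lorB_comm, map_sub, LinearMap.sub_apply, hb, map_smul, LinearMap.smul_apply, smul_eq_mul, sub_self]
    obtain ⟨e, he0, he⟩ := h1
    have hQe : lorentzQ m e = 0 := by
      have := hQ e
      rw [he, lorQ_smul] at this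
      have h2 : μ * (μ - 1) * lorentzQ m e = 0 := by linarith
      exact (mul_eq_zero.1 h2).resolve_left (mul_ne_zero (by linarith) (by linarith))
    have h2 : ∃ e : Vec (m + 2), e ≠ 0 ∧ γ.linear e = μ • e ∧
        lorentzQ m e = 0 ∧ 0 < e (Fin.last (m + 1)) := by
      rcases lt_or_gt_of_ne (lor_last_ne hQe.le he0) with h1 | h1
      · exact ⟨-e, neg_ne_zero.2 he0, by rw [map_neg, he, smul_neg], by rwa [lorQ_neg], by simpa using h1⟩
      · exact ⟨e, he0, he, hQe, h1⟩
    obtain ⟨e, he0, he, hQe, hel⟩ := h2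
    have h3 : lorB m e f ≠ 0 := by
      intro h
      obtain ⟨c, hc⟩ := (lor_perp_null hQf hf0 h).2 hQe
      have h4 : γ.linear e = e := by rw [hc, map_smul, hf]
      rw [he] at h4
      have h5 : (μ - 1) • e = 0 := by rw [sub_smul, h4, one_smul, sub_self]
      rcases smul_eq_zero.1 h5 with h6 | h6
      · linarith
      · exact he0 h6
    have h4 : lorB m e f < 0 := lt_of_le_of_ne (lor_nonpos hQe.le hel hQf.le hfl) h3
    set c := (-lorB m e f)⁻¹ with hc
    have hc0 : 0 < c := inv_pos.2 (by linarith)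
    refine ⟨c • e, smul_ne_zero hc0.ne' he0, ?_, ?_, ?_, ?_⟩
    · rw [map_smul, he, smul_comm]
    · rw [lorQ_smul, hQe, mul_zero]
    · simp only [Pi.smul_apply, smul_eq_mul]; positivity
    · rw [map_smul, LinearMap.smul_apply, smul_eq_mul, hc]
      field_simp
  have ha : ∀ v, lorB m (γ.linear v) e = lorB m v e := by
    intro v
    have := hBp v e
    rw [he, map_smul, smul_eq_mul] at this
    exact mul_left_cancel₀ (by linarith) this
  have hfe : lorB m f e = -1 := by rw [lorB_comm, hef]
  obtain ⟨x0, p0, hx0⟩ : ∃ (x0 : Vec (m + 2)) (p0 : ℝ), γ x0 = x0 + p0 • f := by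
    let T : Vec (m + 2) →ₗ[ℝ] Vec (m + 2) :=
      (γ.linear : Vec (m + 2) →ₗ[ℝ] Vec (m + 2)) - LinearMap.id + ((lorB m).flip e).smulRight f
    have hTa : ∀ x, T x = γ.linear x - x + (lorB m x e) • f := fun x => rfl
    have hinj : Function.Injective T := by
      rw [injective_iff_map_eq_zero]
      intro x hx
      rw [hTa] at hx
      have h1 := congrArg (fun v => lorB m v e) hx
      simp only [map_add, map_sub, map_smul, LinearMap.add_apply, LinearMap.sub_apply,
        LinearMap.smul_apply, ha, hfe, smul_eq_mul, map_zero, LinearMap.zero_apply] at h1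
      have h2 : lorB m x e = 0 := by linarith
      rw [h2, zero_smul, add_zero, sub_eq_zero] at hx
      have h3 : lorentzQ m x = 0 := by
        have := hQ x
        rw [hx] at this
        nlinarith
      have h4 : lorB m x f = 0 := by
        have := hb x
        rw [hx] at this
        nlinarith
      obtain ⟨c, hc⟩ := (lor_perp_null hQf hf0 h4).2 h3
      rw [hc, map_smul, LinearMap.smul_apply, hfe, smul_eq_mul] at h2
      rw [hc, show c = 0 by linarith, zero_smul]
    obtain ⟨x, hx⟩ := LinearMap.surjective_of_injective hinj (-γ 0)
    rw [hTa] at hx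
    refine ⟨x, -lorB m x e, ?_⟩
    rw [aff_apply0, ← neg_neg (γ 0), ← hx]
    module
  have hp0 : p0 ≠ 0 := by
    rintro rfl
    exact hγ1 (hG.free γ hγ ⟨x0, by rw [hx0, zero_smul, add_zero]⟩)
  have hpos := fun {δ : AffGroup (m + 2)} (hδ : δ ∈ Γ) (hs : lorB m (δ.linear f) e < 0) =>
    step1_pos hG hγ hμ hQ hf hf0 hQf hQe hef ha hb hx0 hp0 hδ hs
  have hnonpos : ∀ δ ∈ Γ, lorB m (δ.linear f) e ≤ 0 := by
    intro δ hδ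
    obtain ⟨c, hc, h⟩ := hG.sim δ hδ
    have h1 : lorentzQ m (δ.linear f) = 0 := by rw [h, hQf, mul_zero]
    have h2 := lorB_polar (δ.linear : Vec (m+2) →ₗ[ℝ] Vec (m+2)) c h f (tvec m)
    simp only [LinearEquiv.coe_coe] at h2
    have h3 := lor_neg hQf.le hfl (tvec_mem m)
    have h4 := lor_future h1.le (hG.fut δ hδ _ (tvec_mem m)) (by rw [h2]; exact mul_neg_of_pos_of_neg hc h3)
    exact lor_nonpos h1.le h4 hQe.le hel
  have hinv : ∀ δ ∈ Γ, δ.linear f = f ∧ ∃ c : ℝ, δ x0 = x0 + c • f := by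
    intro δ hδ
    rcases (hnonpos δ hδ).lt_or_eq with hs | hs
    · exact hpos hδ hs
    exfalso
    obtain ⟨c, hc, h⟩ := hG.sim δ hδ
    have h1 : lorentzQ m (δ.linear f) = 0 := by rw [h, hQf, mul_zero]
    have h1e : lorentzQ m (δ.linear e) = 0 := by rw [h, hQe, mul_zero]
    obtain ⟨ν, hν⟩ := (lor_perp_null hQe he0 hs).2 h1
    have hν0 : ν ≠ 0 := by
      rintro rfl
      rw [zero_smul] at hν
      exact hf0 (by simpa using hν)
    have h2 : lorB m (δ.linear e) e ≠ 0 := by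
      intro h3
      obtain ⟨κ, hκ⟩ := (lor_perp_null hQe he0 h3).2 h1e
      have h4 : δ.linear (ν • e - κ • f) = 0 := by
        rw [map_sub, map_smul, map_smul, hκ, hν, smul_smul, smul_smul, mul_comm, sub_self]
      have h5 : ν • e - κ • f = 0 := δ.linear.map_eq_zero_iff.1 h4
      have h6 := congrArg (fun v => lorB m v f) h5
      simp only [map_sub, map_smul, LinearMap.sub_apply, LinearMap.smul_apply, hef, lorB_self, hQf,
        smul_eq_mul, map_zero, LinearMap.zero_apply] at h6
      apply hν0
      linarith
    have h3 : lorB m ((δ * δ).linear f) e < 0 := by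
      refine lt_of_le_of_ne (hnonpos _ (Γ.mul_mem hδ hδ)) ?_
      rw [aff_mul_linear, hν, map_smul, map_smul, LinearMap.smul_apply, smul_eq_mul]
      exact mul_ne_zero hν0 h2
    have h4 := (hpos (Γ.mul_mem hδ hδ) h3).1
    rw [aff_mul_linear, hν, map_smul] at h4
    have h5 : δ⁻¹.linear f = ν • e := by
      rw [← h4, ← map_smul, aff_inv_linear']
    let ζ := γ * δ * γ * δ⁻¹
    have hζ : ζ ∈ Γ := Γ.mul_mem (Γ.mul_mem (Γ.mul_mem hγ hδ) hγ) (Γ.inv_mem hδ)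
    have hζf : ζ.linear f = μ • f := by
      show γ.linear (δ.linear (γ.linear (δ⁻¹.linear f))) = _
      rw [h5, map_smul, he, smul_comm, map_smul, map_smul, map_smul, h4, hf]
    have hQζ : ∀ v, lorentzQ m (ζ.linear v) = μ ^ 2 * lorentzQ m v := by
      intro v
      show lorentzQ m (γ.linear (δ.linear (γ.linear (δ⁻¹.linear v)))) = _
      have h6 := h (δ⁻¹.linear v)
      rw [aff_inv_linear] at h6
      rw [hQ, h, hQ, h6]; ring
    have hζ1 : ζ ≠ 1 := by
      intro h6
      rw [h6] at hζf
      have h7 : f = μ • f := hζf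
      have h8 : (μ - 1) • f = 0 := by rw [sub_smul, ← h7, one_smul, sub_self]
      rcases smul_eq_zero.1 h8 with h9 | h9
      · linarith
      · exact hf0 h9
    obtain ⟨x, hx0', hx⟩ := FP hG.free hζ hζ1
    have h6 : lorentzQ m x = 0 := by
      have := hQζ x
      rw [hx] at this
      have : (μ ^ 2 - 1) * lorentzQ m x = 0 := by linarith
      exact (mul_eq_zero.1 this).resolve_left (by nlinarith)
    have h7 : lorB m x f = 0 := by
      have := lorB_polar (ζ.linear : Vec (m+2) →ₗ[ℝ] Vec (m+2)) _ hQζ x f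
      simp only [LinearEquiv.coe_coe] at this
      rw [hx, hζf, map_smul, smul_eq_mul] at this
      have : μ * (μ - 1) * lorB m x f = 0 := by linarith
      exact (mul_eq_zero.1 this).resolve_left (mul_ne_zero (by linarith) (by linarith))
    obtain ⟨t, ht⟩ := (lor_perp_null hQf hf0 h7).2 h6
    have h8 : x = μ • x := by
      conv_lhs => rw [← hx, ht, map_smul, hζf, smul_comm, ← ht]
    have h9 : (μ - 1) • x = 0 := by rw [sub_smul, ← h8, one_smul, sub_self]
    rcases smul_eq_zero.1 h9 with h9 | h9
    · linarith
    · exact hx0' h9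
  have huniv := INV Γ hG.pd hG.cc (Set.range fun t : ℝ => x0 + t • f)
    (by
      rintro _ ⟨s, rfl⟩ _ ⟨t, rfl⟩ a b _ _ hab
      refine ⟨a * s + b * t, ?_⟩
      have : b = 1 - a := by linarith
      subst this
      simp only
      module)
    ⟨_, 0, rfl⟩
    (by
      rintro δ hδ _ ⟨t, rfl⟩
      obtain ⟨h1, c, h2⟩ := hinv δ hδ
      refine ⟨c + t, ?_⟩
      simp only
      rw [aff_apply, h2, map_smul, h1]
      module)
  obtain ⟨t, ht⟩ : x0 + e ∈ Set.range fun t : ℝ => x0 + t • f := by rw [huniv]; trivial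
  have ht : t • f = e := add_left_cancel ht
  have h1 : lorB m e e = 0 := by rw [lorB_self, hQe]
  have h2 := congrArg (fun v => lorB m v e) ht
  simp only [map_smul, LinearMap.smul_apply, hfe, h1, smul_eq_mul] at h2
  rw [show t = 0 by linarith, zero_smul] at ht
  exact he0 ht.symm

/-- Step 1: all linear parts preserve `Q`. -/
lemma step1 {m : ℕ} {Γ : Subgroup (AffGroup (m + 2))} (hG : Good m Γ) {γ : AffGroup (m + 2)}
    (hγ : γ ∈ Γ) : ∀ v, lorentzQ m (γ.linear v) = lorentzQ m v := by
  obtain ⟨c, hc, h⟩ := hG.sim γ hγ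
  rcases lt_trichotomy c 1 with h1 | h1 | h1
  · exfalso
    refine step1_aux hG (Γ.inv_mem hγ) c⁻¹ (one_lt_inv_iff₀.2 ⟨hc, h1⟩) fun v => ?_
    have := h (γ⁻¹.linear v)
    rw [aff_inv_linear] at this
    rw [this]
    field_simp
  · intro v; rw [h, h1, one_mul]
  · exact (step1_aux hG hγ c h1 h).elim

end Step1


noncomputable section Step2a

open Metric Topology

/-- the linear part as a continuous linear map -/
def lop {n : ℕ} (γ : AffGroup n) : Vec n →L[ℝ] Vec n :=
  LinearMap.toContinuousLinearMap (γ.linear : Vec n →ₗ[ℝ] Vec n)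

lemma lop_apply {n : ℕ} (γ : AffGroup n) (v : Vec n) : lop γ v = γ.linear v := rfl

lemma lop_mul {n : ℕ} (γ δ : AffGroup n) : lop (γ * δ) = lop γ * lop δ := rfl

lemma lop_one {n : ℕ} : lop (1 : AffGroup n) = 1 := rfl

lemma lop_inv_mul {n : ℕ} (γ : AffGroup n) : lop γ⁻¹ * lop γ = 1 := by
  rw [← lop_mul, inv_mul_cancel, lop_one]

lemma lop_mul_inv {n : ℕ} (γ : AffGroup n) : lop γ * lop γ⁻¹ = 1 := by
  rw [← lop_mul, mul_inv_cancel, lop_one]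

lemma finite_of_separated {α E : Type*} [PseudoMetricSpace E] (f : α → E) (S : Set α) (K : Set E)
    (hK : IsCompact K) (hf : ∀ a ∈ S, f a ∈ K) (r : ℝ) (hr : 0 < r)
    (hsep : ∀ a ∈ S, ∀ b ∈ S, dist (f a) (f b) < r → a = b) : S.Finite := by
  obtain ⟨t, -, ht, hcov⟩ := hK.finite_cover_balls (half_pos hr)
  have h1 : ∀ a ∈ S, ∃ x ∈ t, f a ∈ ball x (r / 2) := by
    intro a ha
    have := hcov (hf a ha)
    simpa using this
  rcases S.eq_empty_or_nonempty with rfl | ⟨a0, ha0⟩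
  · exact Set.finite_empty
  have : Nonempty E := ⟨f a0⟩
  choose! g hg using h1
  refine Set.Finite.of_injOn (f := g) (t := t) (fun a ha => (hg a ha).1) ?_ ht
  intro a ha b hb hab
  apply hsep a ha b hb
  have h2 := (hg a ha).2
  have h3 := (hg b hb).2
  rw [mem_ball] at h2 h3
  rw [← hab] at h3
  calc dist (f a) (f b) ≤ dist (f a) (g a) + dist (g a) (f b) := dist_triangle _ _ _
    _ < r / 2 + r / 2 := by rw [dist_comm (g a)]; exact add_lt_add h2 h3
    _ = r := add_halves r

lemma lin_proper {m : ℕ} {Γ : Subgroup (AffGroup (m + 2))} (hG : Good m Γ) (ε : ℝ) (hε : 0 < ε)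
    (hd : ∀ γ ∈ Γ, ‖lop γ - 1‖ < ε → γ = 1) (K : Set (Vec (m + 2))) (hK : IsCompact K)
    (hKF : K ⊆ Fut m) :
    {γ : AffGroup (m + 2) | γ ∈ Γ ∧ ∃ τ ∈ K, γ.linear τ ∈ K}.Finite := by
  obtain ⟨k, C, hk, hC, hb⟩ := nform_bounds K hK fun τ hτ => (hKF hτ).1
  set D := Real.sqrt (C / k) with hDdef
  have hD : 0 < D := Real.sqrt_pos.2 (by positivity)
  have hnorm : ∀ γ ∈ Γ, (∃ τ ∈ K, γ.linear τ ∈ K) → ‖lop γ‖ ≤ D := by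
    rintro γ hγ ⟨τ, hτ, hτ'⟩
    refine ContinuousLinearMap.opNorm_le_bound _ hD.le fun x => ?_
    have hQ := step1 hG hγ
    have hB := lorB_polar (γ.linear : Vec (m+2) →ₗ[ℝ] Vec (m+2)) 1 (by simpa using hQ)
    simp only [LinearEquiv.coe_coe, one_mul] at hB
    have h1 := (hb _ hτ' (γ.linear x)).1
    have h2 := (hb τ hτ x).2
    have h3 : nform m (γ.linear τ) (γ.linear x) = nform m τ x := by
      simp only [nform, hQ, hB]
    rw [h3] at h1
    have h4 : ‖γ.linear x‖ ^ 2 ≤ (D * ‖x‖) ^ 2 := by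
      rw [mul_pow, hDdef, Real.sq_sqrt (by positivity), div_mul_eq_mul_div, le_div_iff₀ hk]
      linarith
    exact (pow_le_pow_iff_left₀ (norm_nonneg _) (by positivity) two_ne_zero).1 h4
  refine finite_of_separated lop _ (closedBall (0 : Vec (m+2) →L[ℝ] Vec (m+2)) D)
    (isCompact_closedBall _ _) ?_ (ε / D) (by positivity) ?_
  · intro γ hγ
    rw [mem_closedBall, dist_zero_right]
    exact hnorm γ hγ.1 hγ.2
  · rintro γ ⟨hγ, τ, hτ, hτ'⟩ δ ⟨hδ, -⟩ hdist
    have h1 : ‖lop γ⁻¹‖ ≤ D := by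
      refine hnorm _ (Γ.inv_mem hγ) ⟨_, hτ', ?_⟩
      rwa [aff_inv_linear']
    have h2 : γ⁻¹ * δ = 1 := by
      apply hd _ (Γ.mul_mem (Γ.inv_mem hγ) hδ)
      have e1 : lop (γ⁻¹ * δ) - 1 = lop γ⁻¹ * (lop δ - lop γ) := by
        rw [mul_sub, lop_inv_mul, lop_mul]
      rw [e1]
      calc ‖lop γ⁻¹ * (lop δ - lop γ)‖ ≤ ‖lop γ⁻¹‖ * ‖lop δ - lop γ‖ := norm_mul_le _ _
        _ ≤ D * ‖lop δ - lop γ‖ := by gcongr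
        _ < D * (ε / D) := by
            gcongr
            rwa [dist_comm, dist_eq_norm] at hdist
        _ = ε := by field_simp
    exact inv_mul_eq_one.1 h2

lemma lorQ_contDiff (m : ℕ) : ContDiff ℝ 1 (lorentzQ m) := by
  unfold lorentzQ
  fun_prop

lemma lorB_fderiv_zero {m : ℕ} (g : Vec (m + 2) → Vec (m + 2)) (q : ℝ) (hg : ∀ x, lorentzQ m (g x) = q)
    (D : Vec (m + 2) →L[ℝ] Vec (m + 2)) (x : Vec (m + 2)) (hD : HasFDerivAt g D x) (v : Vec (m + 2)) :
    lorB m (g x) (D v) = 0 := by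
  let c : ℝ → Vec (m + 2) := fun t => g (x + t • v)
  have hl : HasDerivAt (fun t : ℝ => x + t • v) v 0 := by
    have := ((hasDerivAt_id (0 : ℝ)).smul_const v).const_add x
    simpa using this
  have hc : HasDerivAt c (D v) 0 := by
    have hD' : HasFDerivAt g D (x + (0 : ℝ) • v) := by simpa using hD
    exact hD'.comp_hasDerivAt (0 : ℝ) hl
  have hci := hasDerivAt_pi.1 hc
  have hc0 : c 0 = g x := by simp [c]
  have h1 : HasDerivAt (fun t => lorentzQ m (c t)) (2 * lorB m (g x) (D v)) 0 := by
    have h2 := (HasDerivAt.fun_sum (u := Finset.univ)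
      fun (i : Fin (m + 1)) _ => (hci i.castSucc).pow 2).sub ((hci (Fin.last (m + 1))).pow 2)
    refine h2.congr_deriv ?_
    rw [lorB_apply, mul_sub, Finset.mul_sum, hc0]
    congr 1
    · refine Finset.sum_congr rfl fun i _ => ?_
      simp; ring
    · simp; ring
  have h3 : (fun t => lorentzQ m (c t)) = fun _ => q := funext fun t => hg _
  rw [h3] at h1
  have := h1.unique (hasDerivAt_const _ _)
  linarith

/-- Step 2a: the linear holonomy is not discrete. -/
lemma step2a {m : ℕ} {Γ : Subgroup (AffGroup (m + 2))} (hG : Good m Γ) (ε : ℝ) (hε : 0 < ε)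
    (hd : ∀ γ ∈ Γ, ‖lop γ - 1‖ < ε → γ = 1) : False := by
  obtain ⟨f, hf1, hf2, hf3⟩ := averaging_aff Γ hG.pd hG.cc
    (fun g => ((g : AffGroup (m + 2)).linear : Vec (m+2) →ₗ[ℝ] Vec (m+2)).toAffineMap)
    (fun g h v => rfl) (tvec m)
  have hfF := hf3 (Fut m) (Fut_convex m) fun g => hG.fut g g.2 _ (tvec_mem m)
  have hf2 : ∀ γ ∈ Γ, ∀ x, f (γ x) = γ.linear (f x) := fun γ hγ x => hf2 ⟨γ, hγ⟩ x
  let F1 : Vec (m + 2) → Vec (m + 2) := fun x => (Real.sqrt (-lorentzQ m (f x)))⁻¹ • f x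
  have hsp : ∀ x, 0 < Real.sqrt (-lorentzQ m (f x)) := fun x =>
    Real.sqrt_pos.2 (by have := (hfF x).1; linarith)
  have hF1c : ContDiff ℝ 1 F1 := by
    refine ContDiff.smul (ContDiff.inv ?_ fun x => (hsp x).ne') hf1
    exact ContDiff.sqrt ((lorQ_contDiff m).comp hf1).neg
      fun x => by have := (hfF x).1; linarith
  have hF1Q : ∀ x, lorentzQ m (F1 x) = -1 := by
    intro x
    simp only [F1]
    have := (hfF x).1
    rw [lorQ_smul, inv_pow, Real.sq_sqrt (by linarith)]
    field_simp [this.ne]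
  have hF1F : ∀ x, F1 x ∈ Fut m := by
    intro x
    refine ⟨by rw [hF1Q]; norm_num, ?_⟩
    have h1 := hsp x
    have h2 := (hfF x).2
    simp only [F1, Pi.smul_apply, smul_eq_mul]
    positivity
  have hF1e : ∀ γ ∈ Γ, ∀ x, F1 (γ x) = γ.linear (F1 x) := by
    intro γ hγ x
    simp only [F1]
    rw [hf2 γ hγ, step1 hG hγ, map_smul]
  obtain ⟨K, hK, hKc⟩ := hG.cc
  obtain ⟨K2, hK2, hK2i, hK2F⟩ := exists_compact_between (hK.image hF1c.continuous) (Fut_isOpen m)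
    (by rintro _ ⟨x, -, rfl⟩; exact hF1F x)
  obtain ⟨ψ, hψs, hψc, hψ0⟩ := IsOpen.exists_contDiff_support_eq (n := 1) (isOpen_interior (s := K2))
  have hψ0 : ∀ x, 0 ≤ ψ x := by
    first | exact hψ0 | exact fun x => (hψ0 ⟨x, rfl⟩).1
  have hψK : ∀ x, ψ x ≠ 0 → x ∈ K2 := by
    intro x hx
    have : x ∈ Function.support ψ := hx
    rw [hψs] at this
    exact interior_subset this
  let U : Set (Vec (m + 2)) := {y | y ∈ Fut m ∧ ∃ g : Γ, 0 < ψ ((g : AffGroup (m + 2)).linear y)}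
  have hF1U : ∀ x, F1 x ∈ U := by
    intro x
    refine ⟨hF1F x, ?_⟩
    obtain ⟨γ, hγ, hx⟩ := hKc x
    refine ⟨⟨γ, hγ⟩, lt_of_le_of_ne (hψ0 _) (Ne.symm ?_)⟩
    simp only
    rw [← hF1e γ hγ]
    have : F1 (γ x) ∈ Function.support ψ := by
      rw [hψs]
      exact hK2i ⟨_, hx, rfl⟩
    exact this
  obtain ⟨h, hh1, hh2, -⟩ := averaging (fun (g : Γ) (y : Vec (m + 2)) => (g : AffGroup (m + 2)).linear y)
    (fun g h x => rfl) (fun g => (lop (g : AffGroup (m + 2))).contDiff) U ψ hψc hψ0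
    (fun x hx => hx.2)
    (by
      intro x hx
      obtain ⟨r, hr, hrF⟩ := Metric.nhds_basis_closedBall.mem_iff.1 ((Fut_isOpen m).mem_nhds hx.1)
      refine ⟨closedBall x r, closedBall_mem_nhds x hr, ?_⟩
      have hfin := lin_proper hG ε hε hd (closedBall x r ∪ K2) ((isCompact_closedBall _ _).union hK2)
        (Set.union_subset hrF hK2F)
      refine Set.Finite.of_finite_image (f := Subtype.val) (hfin.subset ?_) Subtype.val_injective.injOn
      rintro _ ⟨g, ⟨y, hy, hne⟩, rfl⟩
      exact ⟨g.2, y, Or.inl hy, Or.inr (hψK _ hne)⟩)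
    (fun g => ((g : AffGroup (m + 2)) : Vec (m + 2) →ᵃ[ℝ] Vec (m + 2))) (fun g h v => rfl) 0
  let F : Vec (m + 2) → Vec (m + 2) := fun x => h (F1 x)
  have hFc : ContDiff ℝ 1 F := contDiff_iff_contDiffAt.2 fun x =>
    (hh1 _ (hF1U x)).comp x hF1c.contDiffAt
  have hFsurj := KL Γ hG.pd hG.cc F hFc (by
    intro γ hγ x
    simp only [F]
    rw [hF1e γ hγ]
    exact hh2 ⟨γ, hγ⟩ _ (hF1U x))
  have hder : ∀ x, HasFDerivAt F ((fderiv ℝ h (F1 x)).comp (fderiv ℝ F1 x)) x := by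
    intro x
    exact (((hh1 _ (hF1U x)).differentiableAt (by norm_num)).hasFDerivAt).comp x
      ((hF1c.differentiable (by norm_num) x).hasFDerivAt)
  have hdet : ∀ x, ((fderiv ℝ h (F1 x)).comp (fderiv ℝ F1 x)).det = 0 := by
    intro x
    have h1 : LinearMap.det ((fderiv ℝ F1 x : Vec (m+2) →L[ℝ] Vec (m+2)) : Vec (m+2) →ₗ[ℝ] Vec (m+2)) = 0 := by
      by_contra hne
      have hu := (LinearMap.isUnit_iff_isUnit_det _).2 (isUnit_iff_ne_zero.2 hne)
      obtain ⟨v, hv⟩ := ((Module.End.isUnit_iff _).1 hu).2 (F1 x)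
      have h2 := lorB_fderiv_zero F1 (-1) hF1Q _ x (hF1c.differentiable (by norm_num) x).hasFDerivAt v
      have hv : fderiv ℝ F1 x v = F1 x := hv
      rw [hv, lorB_self, hF1Q] at h2
      norm_num at h2
    rw [ContinuousLinearMap.det, ContinuousLinearMap.toLinearMap_comp, LinearMap.det_comp, h1, mul_zero]
  have hnull := MeasureTheory.addHaar_image_eq_zero_of_det_fderivWithin_eq_zero
    (MeasureTheory.volume : MeasureTheory.Measure (Vec (m + 2))) (s := Set.univ) (f := F)
    (fun x _ => (hder x).hasFDerivWithinAt) (fun x _ => hdet x)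
  rw [Set.image_univ, hFsurj.range_eq] at hnull
  simp at hnull

end Step2a


noncomputable section Step2b

open Metric Topology

lemma inv_norm_le_two {n : ℕ} (A : AffGroup n) (h : ‖lop A - 1‖ ≤ 1 / 100) : ‖lop A⁻¹‖ ≤ 2 := by
  have h1 : lop A⁻¹ = 1 - lop A⁻¹ * (lop A - 1) := by
    rw [mul_sub, lop_inv_mul, mul_one]; abel
  have h2 : ‖lop A⁻¹‖ ≤ 1 + ‖lop A⁻¹‖ * (1 / 100) := by
    calc ‖lop A⁻¹‖ = ‖1 - lop A⁻¹ * (lop A - 1)‖ := congrArg _ h1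
      _ ≤ ‖(1 : Vec n →L[ℝ] Vec n)‖ + ‖lop A⁻¹ * (lop A - 1)‖ := norm_sub_le _ _
      _ ≤ 1 + ‖lop A⁻¹‖ * (1 / 100) := by
          refine add_le_add ContinuousLinearMap.norm_id_le ?_
          exact (norm_mul_le _ _).trans (by gcongr)
  linarith

lemma comm_lin {n : ℕ} (z s : AffGroup n) (ν : ℝ) (hz : ‖lop z - 1‖ ≤ ν) (hν : ν ≤ 1 / 100)
    (hs : ‖lop s - 1‖ ≤ 1 / 100) :
    ‖lop z * lop s - lop s * lop z‖ ≤ ν / 50 ∧ ‖lop (z * s * z⁻¹ * s⁻¹) - 1‖ ≤ ν / 2 := by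
  have hν0 : 0 ≤ ν := (norm_nonneg _).trans hz
  have e1 : lop z * lop s - lop s * lop z =
      (lop z - 1) * (lop s - 1) - (lop s - 1) * (lop z - 1) := by
    simp only [mul_sub, sub_mul, mul_one, one_mul]; abel
  have h1 : ‖lop z * lop s - lop s * lop z‖ ≤ ν / 50 := by
    rw [e1]
    calc _ ≤ ‖(lop z - 1) * (lop s - 1)‖ + ‖(lop s - 1) * (lop z - 1)‖ := norm_sub_le _ _
      _ ≤ ‖lop z - 1‖ * ‖lop s - 1‖ + ‖lop s - 1‖ * ‖lop z - 1‖ :=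
          add_le_add (norm_mul_le _ _) (norm_mul_le _ _)
      _ ≤ ν * (1 / 100) + (1 / 100) * ν := by gcongr
      _ = ν / 50 := by ring
  refine ⟨h1, ?_⟩
  have e2 : lop (z * s * z⁻¹ * s⁻¹) - 1 = (lop z * lop s - lop s * lop z) * (lop z⁻¹ * lop s⁻¹) := by
    have : lop s * lop z * (lop z⁻¹ * lop s⁻¹) = 1 := by
      rw [← lop_mul, ← lop_mul, ← lop_mul, ← lop_one]
      congr 1; group
    rw [sub_mul, this]
    simp only [lop_mul, mul_assoc]
  rw [e2]
  calc _ ≤ ‖lop z * lop s - lop s * lop z‖ * (‖lop z⁻¹‖ * ‖lop s⁻¹‖) :=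
        (norm_mul_le _ _).trans (by gcongr; exact norm_mul_le _ _)
    _ ≤ (ν / 50) * (2 * 2) := by
        gcongr
        · exact inv_norm_le_two z (hz.trans hν)
        · exact inv_norm_le_two s hs
    _ ≤ ν / 2 := by linarith

lemma comm_trans {n : ℕ} (z s : AffGroup n) (ν σ : ℝ) (hσ : 0 < σ) (hz : ‖lop z - 1‖ ≤ ν)
    (hν : ν ≤ 1 / 100) (hs : ‖lop s - 1‖ ≤ 1 / 100) (hz0 : σ * ‖z 0‖ ≤ ν) (hs0 : σ * ‖s 0‖ ≤ 1 / 100) :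
    σ * ‖(z * s * z⁻¹ * s⁻¹) 0‖ ≤ ν / 2 := by
  have hν0 : 0 ≤ ν := (norm_nonneg _).trans hz
  set w := s⁻¹ 0 with hw
  set y := z⁻¹ w with hy
  have hsw : s w = 0 := aff_inv s 0
  have hzy : z y = w := aff_inv z w
  have h1 : (z * s * z⁻¹ * s⁻¹) 0 = z (s y) := rfl
  have hwn : ‖w‖ ≤ 2 * ‖s 0‖ := by
    have : w = - lop s⁻¹ (s 0) := by
      have h2 : lop s w = - s 0 := by
        have := aff_apply0 s w
        rw [hsw] at this
        rw [lop_apply]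
        exact eq_neg_of_add_eq_zero_right this.symm
      rw [← map_neg, ← h2]
      exact (aff_inv_linear' s w).symm
    rw [this, norm_neg]
    exact ((lop s⁻¹).le_opNorm _).trans (by gcongr; exact inv_norm_le_two s hs)
  have hyn : ‖y‖ ≤ 2 * (2 * ‖s 0‖ + ‖z 0‖) := by
    have : y = lop z⁻¹ (w - z 0) := by
      have h2 : lop z y = w - z 0 := by
        have := aff_apply0 z y
        rw [hzy] at this
        rw [lop_apply, this]; abel
      rw [← h2]
      exact (aff_inv_linear' z y).symm
    rw [this]
    calc _ ≤ ‖lop z⁻¹‖ * ‖w - z 0‖ := (lop z⁻¹).le_opNorm _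
      _ ≤ 2 * (2 * ‖s 0‖ + ‖z 0‖) := by
        gcongr
        · exact inv_norm_le_two z (hz.trans hν)
        · exact (norm_sub_le _ _).trans (by gcongr)
  have e : z (s y) = (lop z * lop s - lop s * lop z) y + (lop z - 1) (s 0) - (lop s - 1) (z 0) := by
    have h0 : s (z y) = 0 := by rw [hzy, hsw]
    have a1 : z (s y) = z 0 + lop z (s 0) + lop z (lop s y) := by
      rw [aff_apply0 z (s y), aff_apply0 s y, map_add, add_assoc]; rfl
    have a2 : s (z y) = s 0 + lop s (z 0) + lop s (lop z y) := by
      rw [aff_apply0 s (z y), aff_apply0 z y, map_add, add_assoc]; rfl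
    rw [h0] at a2
    rw [a1]
    have : z 0 + lop z (s 0) + lop z (lop s y) =
      z 0 + lop z (s 0) + lop z (lop s y) - (s 0 + lop s (z 0) + lop s (lop z y)) := by
        rw [← a2, sub_zero]
    rw [this]
    change _ = (lop z (lop s y) - lop s (lop z y)) + (lop z (s 0) - s 0) - (lop s (z 0) - z 0)
    abel
  rw [h1, e]
  have n1 := (comm_lin z s ν hz hν hs).1
  have b1 : ‖(lop z * lop s - lop s * lop z) y‖ ≤ ν / 50 * ‖y‖ :=
    ((lop z * lop s - lop s * lop z).le_opNorm _).trans (by gcongr)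
  have b2 : ‖(lop z - 1) (s 0)‖ ≤ ν * ‖s 0‖ := ((lop z - 1).le_opNorm _).trans (by gcongr)
  have b3 : ‖(lop s - 1) (z 0)‖ ≤ 1 / 100 * ‖z 0‖ := ((lop s - 1).le_opNorm _).trans (by gcongr)
  have b4 : ‖(lop z * lop s - lop s * lop z) y + (lop z - 1) (s 0) - (lop s - 1) (z 0)‖ ≤
      ν / 50 * ‖y‖ + ν * ‖s 0‖ + 1 / 100 * ‖z 0‖ := by
    refine (norm_sub_le _ _).trans (add_le_add ((norm_add_le _ _).trans (add_le_add b1 b2)) b3)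
  have b5 : σ * ‖y‖ ≤ 6 / 100 := by nlinarith
  calc _ ≤ σ * (ν / 50 * ‖y‖ + ν * ‖s 0‖ + 1 / 100 * ‖z 0‖) := by gcongr
    _ = ν / 50 * (σ * ‖y‖) + ν * (σ * ‖s 0‖) + 1 / 100 * (σ * ‖z 0‖) := by ring
    _ ≤ ν / 50 * (6 / 100) + ν * (1 / 100) + 1 / 100 * ν := by gcongr
    _ ≤ ν / 2 := by linarith

lemma inj_comm {m : ℕ} {Γ : Subgroup (AffGroup (m + 2))} (hG : Good m Γ) {γ δ : AffGroup (m + 2)}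
    (hγ : γ ∈ Γ) (hδ : δ ∈ Γ) (h : lop γ * lop δ = lop δ * lop γ) : γ * δ = δ * γ := by
  have h1 : (δ * γ)⁻¹ * (γ * δ) = 1 := by
    refine hG.inj _ (Γ.mul_mem (Γ.inv_mem (Γ.mul_mem hδ hγ)) (Γ.mul_mem hγ hδ)) fun v => ?_
    have : lop ((δ * γ)⁻¹ * (γ * δ)) = 1 := by
      rw [lop_mul, lop_mul γ, h, ← lop_mul δ, lop_inv_mul]
    exact congrArg (fun T : Vec (m+2) →L[ℝ] Vec (m+2) => T v) this
  exact (inv_mul_eq_one.1 h1).symm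

/-- elements of the group with linear part near the identity -/
def Near {n : ℕ} (Γ : Subgroup (AffGroup n)) (ε : ℝ) : Set (AffGroup n) :=
  {γ | γ ∈ Γ ∧ ‖lop γ - 1‖ < ε}

/-- commutant of the linear parts near the identity -/
def Cen {n : ℕ} (Γ : Subgroup (AffGroup n)) (ε : ℝ) : Subalgebra ℝ (Vec n →L[ℝ] Vec n) :=
  Subalgebra.centralizer ℝ (lop '' Near Γ ε)

lemma Cen_mem {n : ℕ} (Γ : Subgroup (AffGroup n)) (ε : ℝ) (T : Vec n →L[ℝ] Vec n) :
    T ∈ Cen Γ ε ↔ ∀ γ ∈ Near Γ ε, lop γ * T = T * lop γ := by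
  rw [Cen, Subalgebra.mem_centralizer_iff]
  simp

lemma Cen_stable {n : ℕ} (Γ : Subgroup (AffGroup n)) :
    ∃ ε0 : ℝ, 0 < ε0 ∧ ε0 ≤ 1 / 100 ∧ ∀ ε, 0 < ε → ε ≤ ε0 → Cen Γ ε = Cen Γ ε0 := by
  let P : ℕ → Prop := fun k => ∃ ε : ℝ, 0 < ε ∧ ε ≤ 1 / 100 ∧
    Module.finrank ℝ (Subalgebra.toSubmodule (Cen Γ ε)) = k
  classical
  have hb : ∀ k, P k → k ≤ Module.finrank ℝ (Vec n →L[ℝ] Vec n) := by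
    rintro k ⟨ε, -, -, rfl⟩
    exact Submodule.finrank_le _
  have hP0 : P _ := ⟨1 / 100, by norm_num, le_rfl, rfl⟩
  have hP := Nat.findGreatest_spec (hb _ hP0) hP0
  obtain ⟨ε0, h0, h1, h2⟩ := hP
  refine ⟨ε0, h0, h1, fun ε hε hle => ?_⟩
  have hsub : Cen Γ ε0 ≤ Cen Γ ε := by
    intro T hT
    rw [Cen_mem] at hT ⊢
    exact fun γ hγ => hT γ ⟨hγ.1, hγ.2.trans_le hle⟩
  have h3 := Nat.le_findGreatest (P := P) (hb _ ⟨ε, hε, hle.trans h1, rfl⟩) ⟨ε, hε, hle.trans h1, rfl⟩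
  rw [← h2] at h3
  have := Submodule.eq_of_le_of_finrank_le (S₁ := Subalgebra.toSubmodule (Cen Γ ε0))
    (S₂ := Subalgebra.toSubmodule (Cen Γ ε)) hsub h3
  exact (Subalgebra.toSubmodule_injective this).symm

lemma Cen_span {n : ℕ} (Γ : Subgroup (AffGroup n)) (ε : ℝ) :
    ∃ S : Set (AffGroup n), S.Finite ∧ S ⊆ Near Γ ε ∧
      ∀ T : Vec n →L[ℝ] Vec n, (∀ s ∈ S, lop s * T = T * lop s) → T ∈ Cen Γ ε := by
  obtain ⟨b, hb1, hb2, hb3⟩ := exists_linearIndependent ℝ (lop '' Near Γ ε)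
  have hbf : b.Finite := hb3.setFinite
  choose! φ hφ using hb1
  refine ⟨φ '' b, hbf.image _, ?_, ?_⟩
  · rintro _ ⟨x, hx, rfl⟩
    exact (hφ hx).1
  · intro T hT
    rw [Cen_mem]
    intro γ hγ
    have h1 : lop γ ∈ Submodule.span ℝ b := by
      rw [hb2]; exact Submodule.subset_span ⟨γ, hγ, rfl⟩
    generalize lop γ = x at h1
    induction h1 using Submodule.span_induction with
    | mem x hx =>
      have := hT _ ⟨x, hx, rfl⟩
      rwa [(hφ hx).2] at this
    | zero => simp
    | add x y _ _ hx hy => rw [add_mul, mul_add, hx, hy]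
    | smul a x _ hx => rw [smul_mul_assoc, hx, mul_smul_comm]

/-- Step 2b. -/
lemma step2b {m : ℕ} {Γ : Subgroup (AffGroup (m + 2))} (hG : Good m Γ) :
    ∃ A : Subgroup (AffGroup (m + 2)), A ≤ Γ ∧ (∀ g ∈ A, ∀ h ∈ A, g * h = h * g) ∧
      (∀ η ∈ Γ, ∀ g ∈ A, η * g * η⁻¹ ∈ A) ∧ ∃ g ∈ A, g ≠ 1 := by
  obtain ⟨ε0, h0, h1, hst⟩ := Cen_stable Γ
  obtain ⟨S, hSf, hSN, hSC⟩ := Cen_span Γ ε0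
  obtain ⟨g1, hg1, hg1n, hg1'⟩ : ∃ γ ∈ Γ, ‖lop γ - 1‖ < ε0 ∧ γ ≠ 1 := by
    by_contra hno
    push Not at hno
    exact step2a hG ε0 h0 hno
  obtain ⟨σ, hσ, hσS⟩ : ∃ σ : ℝ, 0 < σ ∧ ∀ s ∈ insert g1 S, σ * ‖s 0‖ ≤ ε0 := by
    obtain ⟨M, hM⟩ := ((hSf.insert g1).image fun s : AffGroup (m + 2) => ‖s 0‖).bddAbove
    refine ⟨ε0 / (|M| + 1), by positivity, fun s hs => ?_⟩
    have h2 : ‖s 0‖ ≤ M := hM ⟨s, hs, rfl⟩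
    rw [div_mul_eq_mul_div, div_le_iff₀ (by positivity)]
    gcongr
    linarith [le_abs_self M]
  let T : Set (AffGroup (m + 2)) := {g | g ∈ Γ ∧ g ≠ 1 ∧ ‖lop g - 1‖ < ε0 ∧ σ * ‖g 0‖ ≤ ε0}
  have hTf : T.Finite := by
    refine (hG.pd (closedBall 0 (ε0 / σ)) (isCompact_closedBall _ _)).subset ?_
    rintro g ⟨hg, -, -, h2⟩
    refine ⟨hg, g 0, ⟨0, mem_closedBall_self (by positivity), rfl⟩, ?_⟩
    rw [mem_closedBall, dist_zero_right, le_div_iff₀ hσ, mul_comm]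
    exact h2
  have hTne : T.Nonempty := ⟨g1, hg1, hg1', hg1n, hσS g1 (Set.mem_insert _ _)⟩
  obtain ⟨z, ⟨hzΓ, hz1, hzl, hzt⟩, hzmin⟩ := Set.exists_min_image T
    (fun g => max ‖lop g - 1‖ (σ * ‖g 0‖)) hTf hTne
  set ν := max ‖lop z - 1‖ (σ * ‖z 0‖) with hνdef
  have hνe : ν ≤ ε0 := max_le hzl.le hzt
  have hνpos : 0 < ν := by
    refine lt_of_lt_of_le ?_ (le_max_left _ _)
    rw [norm_pos_iff, sub_ne_zero]
    intro h
    apply hz1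
    refine hG.inj z hzΓ fun v => ?_
    exact congrArg (fun T : Vec (m+2) →L[ℝ] Vec (m+2) => T v) h
  have hzs : ∀ s ∈ S, lop s * lop z = lop z * lop s := by
    intro s hs
    have hsN := hSN hs
    have hs1 : ‖lop s - 1‖ ≤ 1 / 100 := hsN.2.le.trans h1
    have c1 := (comm_lin z s ν (le_max_left _ _) (hνe.trans h1) hs1).2
    have c2 := comm_trans z s ν σ hσ (le_max_left _ _) (hνe.trans h1) hs1 (le_max_right _ _)
      ((hσS s (Set.mem_insert_of_mem _ hs)).trans h1)
    have hc : z * s * z⁻¹ * s⁻¹ = 1 := by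
      by_contra hne
      have := hzmin (z * s * z⁻¹ * s⁻¹) ⟨Γ.mul_mem (Γ.mul_mem (Γ.mul_mem hzΓ hsN.1) (Γ.inv_mem hzΓ))
        (Γ.inv_mem hsN.1), hne, by linarith, by linarith⟩
      have h5 := max_le c1 c2
      linarith
    have : z * s = s * z := by
      have h5 := congrArg (fun g => g * s * z) hc
      simpa [mul_assoc] using h5
    rw [← lop_mul, ← lop_mul, this]
  have hzC := hSC _ hzs
  let Z : Subgroup (AffGroup (m + 2)) := Γ ⊓ Subgroup.centralizer (Near Γ ε0)
  have hZ : ∀ γ, γ ∈ Z ↔ γ ∈ Γ ∧ lop γ ∈ Cen Γ ε0 := by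
    intro γ
    simp only [Z, Subgroup.mem_inf, Subgroup.mem_centralizer_iff, Cen_mem]
    refine and_congr_right fun hγ => forall₂_congr fun δ hδ => ⟨fun h => ?_, fun h => ?_⟩
    · rw [← lop_mul, h, lop_mul]
    · exact inj_comm hG hδ.1 hγ h
  have hZn : ∀ η ∈ Γ, ∀ γ ∈ Z, η * γ * η⁻¹ ∈ Z := by
    intro η hη γ hγ
    rw [hZ] at hγ ⊢
    refine ⟨Γ.mul_mem (Γ.mul_mem hη hγ.1) (Γ.inv_mem hη), ?_⟩
    set k := ‖lop η⁻¹‖ * ‖lop η‖ + 1 with hk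
    have hkp : 1 ≤ k := by rw [hk]; linarith [mul_nonneg (norm_nonneg (lop η⁻¹)) (norm_nonneg (lop η))]
    rw [← hst (ε0 / k) (by positivity) (div_le_self h0.le hkp), Cen_mem]
    intro δ hδ
    have hδ' : η⁻¹ * δ * η ∈ Near Γ ε0 := by
      refine ⟨Γ.mul_mem (Γ.mul_mem (Γ.inv_mem hη) hδ.1) hη, ?_⟩
      have e1 : lop (η⁻¹ * δ * η) - 1 = lop η⁻¹ * (lop δ - 1) * lop η := by
        rw [mul_sub, sub_mul, mul_one, lop_inv_mul, lop_mul, lop_mul]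
      rw [e1]
      calc _ ≤ ‖lop η⁻¹‖ * ‖lop δ - 1‖ * ‖lop η‖ :=
            (norm_mul_le _ _).trans (by gcongr; exact norm_mul_le _ _)
        _ = (‖lop η⁻¹‖ * ‖lop η‖) * ‖lop δ - 1‖ := by ring
        _ ≤ k * ‖lop δ - 1‖ := by gcongr; linarith
        _ < k * (ε0 / k) := by gcongr; exact hδ.2
        _ = ε0 := by field_simp
    have h5 := (Cen_mem _ _ _).1 hγ.2 _ hδ'
    rw [← lop_mul, ← lop_mul] at h5
    have h6 := inj_comm hG hδ'.1 hγ.1 (by rw [← lop_mul, ← lop_mul, h5])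
    rw [← lop_mul, ← lop_mul]
    congr 1
    have h7 := congrArg (fun g => η * g * η⁻¹) h6
    simpa [mul_assoc] using h7
  refine ⟨Z ⊓ Subgroup.centralizer (Z : Set (AffGroup (m + 2))), fun g hg => hg.1.1, ?_, ?_, z, ⟨?_, ?_⟩, hz1⟩
  · intro g hg h hh
    exact (Subgroup.mem_centralizer_iff.1 hg.2 h hh.1).symm
  · intro η hη g hg
    refine ⟨hZn η hη g hg.1, Subgroup.mem_centralizer_iff.2 fun h hh => ?_⟩
    have h5 := hZn η⁻¹ (Γ.inv_mem hη) h hh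
    have h6 := Subgroup.mem_centralizer_iff.1 hg.2 _ h5
    have h7 := congrArg (fun g => η * g * η⁻¹) h6
    simpa [mul_assoc] using h7
  · exact (hZ z).2 ⟨hzΓ, hzC⟩
  · refine Subgroup.mem_centralizer_iff.2 fun h hh => ?_
    have h5 := (hZ h).1 hh
    exact inj_comm hG h5.1 hzΓ ((Cen_mem _ _ _).1 h5.2 z ⟨hzΓ, hzl⟩).symm

end Step2b


noncomputable section Step3

/-- the linear part as an endomorphism -/
def lend {n : ℕ} (γ : AffGroup n) : Module.End ℝ (Vec n) := (γ.linear : Vec n →ₗ[ℝ] Vec n)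

/-- linear part minus the identity -/
def Dg {n : ℕ} (γ : AffGroup n) : Module.End ℝ (Vec n) := lend γ - 1

lemma lend_apply {n : ℕ} (γ : AffGroup n) (v : Vec n) : lend γ v = γ.linear v := rfl

lemma Dg_apply {n : ℕ} (γ : AffGroup n) (v : Vec n) : Dg γ v = γ.linear v - v := rfl

lemma lend_mul {n : ℕ} (γ δ : AffGroup n) : lend (γ * δ) = lend γ * lend δ := rfl

lemma Dg_semiconj {n : ℕ} {η g g' : AffGroup n} (h : g * η = η * g') (k : ℕ) (v : Vec n) :
    (Dg g ^ k) (η.linear v) = η.linear ((Dg g' ^ k) v) := by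
  have h1 : SemiconjBy (lend η) (Dg g') (Dg g) := by
    unfold SemiconjBy Dg
    rw [mul_sub, sub_mul, ← lend_mul, ← lend_mul, h, mul_one, one_mul]
  have h2 := h1.pow_right k
  exact (congrArg (fun T : Module.End ℝ (Vec n) => T v) h2.eq).symm

lemma aff_sub {n : ℕ} (γ : AffGroup n) (x y : Vec n) : γ x - γ y = γ.linear (x - y) := by
  rw [aff_apply0 γ x, aff_apply0 γ y, map_sub]; abel

lemma aff_diff {n : ℕ} (γ : AffGroup n) (x v : Vec n) :
    γ (x + v) - (x + v) = (γ x - x) + Dg γ v := by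
  rw [aff_apply, Dg_apply]; abel

/-- inductive data: an invariant affine subspace -/
def InvAff {n : ℕ} (A : Subgroup (AffGroup n)) (x : Vec n) (W : Submodule ℝ (Vec n)) : Prop :=
  ∀ g ∈ A, g x - x ∈ W ∧ ∀ w ∈ W, g.linear w ∈ W

lemma exists_min_inv {n : ℕ} (A : Subgroup (AffGroup n)) : ∃ (x : Vec n) (W : Submodule ℝ (Vec n)),
    InvAff A x W ∧ ∀ x' W', InvAff A x' W' → Module.finrank ℝ W ≤ Module.finrank ℝ W' := by
  classical
  have h : ∃ k, ∃ (x : Vec n) (W : Submodule ℝ (Vec n)), InvAff A x W ∧ Module.finrank ℝ W = k :=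
    ⟨_, 0, ⊤, fun g _ => ⟨trivial, fun _ _ => trivial⟩, rfl⟩
  obtain ⟨x, W, h1, h2⟩ := Nat.find_spec h
  refine ⟨x, W, h1, fun x' W' h' => ?_⟩
  rw [h2]
  exact Nat.find_min' h ⟨x', W', h', rfl⟩

lemma ker_stab {n : ℕ} (T : Module.End ℝ (Vec n)) (v : Vec n) (h : (T ^ (n + 1)) v = 0) :
    (T ^ n) v = 0 := by
  have h1 := Module.End.ker_pow_eq_ker_pow_finrank_of_le (f := T) (m := n + 1)
    (by rw [Module.finrank_fin_fun]; omega)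
  rw [Module.finrank_fin_fun] at h1
  have : v ∈ LinearMap.ker (T ^ (n + 1)) := h
  rw [h1] at this
  exact this

/-- Fitting decomposition inside an invariant subspace -/
lemma fitting {n : ℕ} (T : Module.End ℝ (Vec n)) (W : Submodule ℝ (Vec n)) (hW : ∀ w ∈ W, T w ∈ W)
    (u : Vec n) (hu : u ∈ W) (hn : 0 < n) : ∃ w ∈ W, (T ^ n) (u + T w) = 0 := by
  have hpow : ∀ k : ℕ, ∀ w ∈ W, (T ^ k) w ∈ W := by
    intro k
    induction k with
    | zero => intro w hw; simpa using hw
    | succ k ih => intro w hw; rw [pow_succ']; exact hW _ (ih _ hw)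
  -- the restriction of `T ^ n` to `T ^ n W` is injective, hence onto
  let R : Submodule ℝ (Vec n) := W.map (T ^ n)
  have hR : ∀ r ∈ R, (T ^ n) r ∈ R := by
    rintro _ ⟨w, hw, rfl⟩
    exact ⟨(T ^ n) w, hpow n w hw, rfl⟩
  let f : R →ₗ[ℝ] R := (T ^ n).restrict hR
  have hstab : ∀ k : ℕ, ∀ v, (T ^ (n + k)) v = 0 → (T ^ n) v = 0 := by
    intro k
    induction k with
    | zero => intro v hv; exact hv
    | succ k ih =>
      intro v hv
      have h1 : (T ^ (n + k)) (T v) = 0 := by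
        rw [← Module.End.mul_apply, ← pow_succ]; exact hv
      have h2 := ih _ h1
      rw [← Module.End.mul_apply, ← pow_succ] at h2
      exact ker_stab T v h2
  have hf : Function.Injective f := by
    rw [injective_iff_map_eq_zero]
    rintro ⟨r, w, hw, rfl⟩ h
    have h1 : (T ^ n) ((T ^ n) w) = 0 := congrArg Subtype.val h
    rw [← Module.End.mul_apply, ← pow_add] at h1
    exact Subtype.ext (hstab n w h1)
  obtain ⟨⟨r, w, hw, rfl⟩, h1⟩ := LinearMap.surjective_of_injective hf ⟨(T ^ n) u, u, hu, rfl⟩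
  have h2 : (T ^ n) ((T ^ n) w) = (T ^ n) u := congrArg Subtype.val h1
  refine ⟨-((T ^ (n - 1)) w), W.neg_mem (hpow _ _ hw), ?_⟩
  have h3 : T ((T ^ (n - 1)) w) = (T ^ n) w := by
    rw [← Module.End.mul_apply, ← pow_succ', Nat.sub_add_cancel hn]
  rw [map_neg, h3, map_add, map_neg, h2, add_neg_cancel]

lemma exists_common {n : ℕ} (hn : 0 < n) (A : Subgroup (AffGroup n))
    (hcomm : ∀ g ∈ A, ∀ h ∈ A, g * h = h * g) :
    ∃ x : Vec n, ∀ g ∈ A, (Dg g ^ n) (g x - x) = 0 := by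
  obtain ⟨x, W, hinv, hmin⟩ := exists_min_inv A
  refine ⟨x, fun g hg => ?_⟩
  obtain ⟨w, hw, hw0⟩ := fitting (Dg g) W (fun w hw => W.sub_mem ((hinv g hg).2 w hw) hw)
    (g x - x) (hinv g hg).1 hn
  let W' : Submodule ℝ (Vec n) := W ⊓ LinearMap.ker (Dg g ^ n)
  have hx' : (Dg g ^ n) (g (x + w) - (x + w)) = 0 := by rw [aff_diff]; exact hw0
  have hinv' : InvAff A (x + w) W' := by
    intro h hh
    have hgh := hcomm g hg h hh
    refine ⟨⟨?_, ?_⟩, ?_⟩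
    · change h (x + w) - (x + w) ∈ W
      rw [aff_diff]
      exact W.add_mem (hinv h hh).1 (W.sub_mem ((hinv h hh).2 w hw) hw)
    · change (Dg g ^ n) (h (x + w) - (x + w)) = 0
      apply ker_stab
      rw [pow_succ, Module.End.mul_apply]
      have e1 : Dg g (h (x + w) - (x + w)) =
          h.linear (g (x + w) - (x + w)) - (g (x + w) - (x + w)) := by
        rw [Dg_apply, ← aff_sub, ← aff_sub, ← aff_mul, ← aff_mul, hgh]
        abel
      rw [e1, map_sub, hx', Dg_semiconj hgh, hx', map_zero, sub_zero]
    · rintro v ⟨hv1, hv2⟩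
      refine ⟨(hinv h hh).2 v hv1, ?_⟩
      change (Dg g ^ n) (h.linear v) = 0
      have hv2 : (Dg g ^ n) v = 0 := hv2
      rw [Dg_semiconj hgh, hv2, map_zero]
  have hle : W' ≤ W := inf_le_left
  have heq := Submodule.eq_of_le_of_finrank_le hle (hmin _ _ hinv')
  have : g x - x ∈ W' := by rw [heq]; exact (hinv g hg).1
  exact this.2

/-- Step 3: abelian normal subgroups are unipotent -/
lemma step3 {n : ℕ} (hn : 0 < n) {Γ : Subgroup (AffGroup n)} (hPD : ProperlyDisc Γ) (hCC : CocompactAction Γ)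
    (A : Subgroup (AffGroup n)) (hcomm : ∀ g ∈ A, ∀ h ∈ A, g * h = h * g)
    (hnorm : ∀ η ∈ Γ, ∀ g ∈ A, η * g * η⁻¹ ∈ A) : ∀ g ∈ A, (Dg g) ^ n = 0 := by
  let T : Set (Vec n) := {x | ∀ g ∈ A, (Dg g ^ n) (g x - x) = 0}
  have hT : T = Set.univ := by
    refine INV Γ hPD hCC T ?_ (exists_common hn A hcomm) ?_
    · intro x hx y hy a b _ _ hab g hg
      have e : g (a • x + b • y) - (a • x + b • y) = a • (g x - x) + b • (g y - y) := by
        rw [aff_apply0 g (a • x + b • y), aff_apply0 g x, aff_apply0 g y, map_add, map_smul, map_smul]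
        have : g 0 = a • g 0 + b • g 0 := by rw [← add_smul, hab, one_smul]
        nth_rewrite 1 [this]
        module
      rw [e, map_add, map_smul, map_smul, hx g hg, hy g hg]
      simp
    · intro η hη x hx g hg
      have hg' : η⁻¹ * g * η ∈ A := by
        have := hnorm η⁻¹ (Γ.inv_mem hη) g hg
        rwa [inv_inv] at this
      have h1 : g * η = η * (η⁻¹ * g * η) := by group
      have e : g (η x) - η x = η.linear ((η⁻¹ * g * η) x - x) := by
        rw [← aff_sub, ← aff_mul, ← aff_mul, h1]
      rw [e, Dg_semiconj h1, hx _ hg', map_zero]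
  intro g hg
  have h1 : ∀ x, (Dg g ^ n) (g x - x) = 0 := by
    intro x
    have : x ∈ T := by rw [hT]; trivial
    exact this g hg
  apply LinearMap.ext
  intro v
  apply ker_stab
  have h2 := h1 (0 + v)
  rw [aff_diff, map_add, h1 0, zero_add] at h2
  rw [pow_succ]
  exact h2

end Step3


noncomputable section Step4

lemma isoB {m : ℕ} {Γ : Subgroup (AffGroup (m + 2))} (hG : Good m Γ) {γ : AffGroup (m + 2)}
    (hγ : γ ∈ Γ) (x y : Vec (m + 2)) : lorB m (γ.linear x) (γ.linear y) = lorB m x y := by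
  have hB := lorB_polar (γ.linear : Vec (m+2) →ₗ[ℝ] Vec (m+2)) 1 (by simpa using step1 hG hγ) x y
  simpa using hB

/-- the normal form of the situation -/
structure Frame (m : ℕ) (Γ A : Subgroup (AffGroup (m + 2))) (e f : Vec (m + 2)) : Prop where
  good : Good m Γ
  le : A ≤ Γ
  comm : ∀ g ∈ A, ∀ h ∈ A, g * h = h * g
  norm : ∀ η ∈ Γ, ∀ g ∈ A, η * g * η⁻¹ ∈ A
  e0 : e ≠ 0
  eQ : lorentzQ m e = 0
  fQ : lorentzQ m f = 0
  fe : lorB m f e = 1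
  fixA : ∀ h ∈ A, h.linear e = e
  fixG : ∀ η ∈ Γ, ∃ α : ℝ, 0 < α ∧ η.linear e = α • e
  perp : ∀ h ∈ A, ∀ w, lorB m w e = 0 → ∃ c : ℝ, Dg h w = c • e

lemma null_sign {m : ℕ} {e x y : Vec (m + 2)} (he : lorentzQ m e = 0) (he0 : e ≠ 0) (hx : x ∈ Fut m)
    (hy : y ∈ Fut m) : 0 < lorB m e x * lorB m e y := by
  rcases lt_or_gt_of_ne (lor_last_ne he.le he0) with h1 | h1
  · have a := lor_neg (x := -e) (by rw [lorQ_neg]; exact he.le) (by simpa using h1) hx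
    have b := lor_neg (x := -e) (by rw [lorQ_neg]; exact he.le) (by simpa using h1) hy
    rw [map_neg, LinearMap.neg_apply] at a b
    exact mul_pos (by linarith) (by linarith)
  · exact mul_pos_of_neg_of_neg (lor_neg he.le h1 hx) (lor_neg he.le h1 hy)

lemma perp_fixed {m : ℕ} {Γ : Subgroup (AffGroup (m + 2))} (hG : Good m Γ) {γ : AffGroup (m + 2)}
    (hγ : γ ∈ Γ) {u : Vec (m + 2)} (hu : Dg γ u = 0) (y : Vec (m + 2)) : lorB m u (Dg γ y) = 0 := by
  have h1 : γ.linear u = u := sub_eq_zero.1 hu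
  have h2 := isoB hG hγ u y
  rw [h1] at h2
  rw [Dg_apply, map_sub, h2, sub_self]

lemma perp_aux {m : ℕ} {Γ : Subgroup (AffGroup (m + 2))} (hG : Good m Γ) {h : AffGroup (m + 2)}
    (hh : h ∈ Γ) {e : Vec (m + 2)} (he0 : e ≠ 0) (heQ : lorentzQ m e = 0) (he : h.linear e = e)
    (hnil : (Dg h) ^ (m + 2) = 0) (w : Vec (m + 2)) (hw : lorB m w e = 0) :
    ∃ c : ℝ, Dg h w = c • e := by
  classical
  have hDe : Dg h e = 0 := by rw [Dg_apply, he, sub_self]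
  have hP : ∀ j : ℕ, lorB m ((Dg h ^ j) w) e = 0 := by
    intro j
    cases j with
    | zero => simpa using hw
    | succ j =>
      rw [pow_succ', Module.End.mul_apply, lorB_comm]
      exact perp_fixed hG hh hDe _
  have hex : ∃ j : ℕ, ∃ c : ℝ, (Dg h ^ j) w = c • e := ⟨m + 2, 0, by rw [hnil]; simp⟩
  obtain ⟨c, hc⟩ := Nat.find_spec hex
  have hmin := fun k => Nat.find_min hex (m := k)
  generalize Nat.find hex = j at hc hmin
  match j, hc, hmin with
  | 0, hc, _ =>
    refine ⟨0, ?_⟩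
    have : w = c • e := by simpa using hc
    rw [this, map_smul, hDe, smul_zero, zero_smul]
  | 1, hc, _ => exact ⟨c, by simpa using hc⟩
  | k + 2, hc, hmin =>
    exfalso
    set y := (Dg h ^ k) w with hy
    set u := (Dg h ^ (k + 1)) w with hu
    have hu' : Dg h y = u := by rw [hy, hu, pow_succ', Module.End.mul_apply]
    have hu2 : Dg h u = c • e := by rw [hu, ← hc, pow_succ' _ (k + 1), Module.End.mul_apply]
    have ly : h.linear y = y + u := by rw [← hu', Dg_apply]; abel
    have lu : h.linear u = u + c • e := by rw [← hu2, Dg_apply]; abel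
    have h1 := isoB hG hh y u
    rw [ly, lu] at h1
    simp only [map_add, map_smul, LinearMap.add_apply, smul_eq_mul] at h1
    rw [hP k, hP (k + 1), lorB_self] at h1
    have h2 : lorentzQ m u = 0 := by linarith
    exact hmin (k + 1) (by omega) ((lor_perp_null heQ he0 (hP (k + 1))).2 h2)

lemma exists_frame {m : ℕ} {Γ : Subgroup (AffGroup (m + 2))} (hG : Good m Γ) :
    ∃ A e f, Frame m Γ A e f ∧ ∃ g ∈ A, g ≠ 1 := by
  obtain ⟨A, hA, hcomm, hnorm, g0, hg0, hg01⟩ := step2b hG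
  have hnil := step3 (by omega) hG.pd hG.cc A hcomm hnorm
  classical
  have hD0 : Dg g0 ≠ 0 := by
    intro h
    apply hg01
    refine hG.inj g0 (hA hg0) fun v => ?_
    have := congrArg (fun T : Module.End ℝ (Vec (m+2)) => T v) h
    exact sub_eq_zero.1 this
  obtain ⟨k, hk1, hk2⟩ : ∃ k : ℕ, (Dg g0) ^ (k + 1) ≠ 0 ∧ (Dg g0) ^ (k + 2) = 0 := by
    have hex : ∃ j : ℕ, (Dg g0) ^ j = 0 := ⟨_, hnil g0 hg0⟩
    have hs := Nat.find_spec hex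
    have hmin := fun k => Nat.find_min hex (m := k)
    generalize Nat.find hex = j at hs hmin
    match j, hs, hmin with
    | 0, hs, _ =>
      exfalso; apply hD0
      rw [pow_zero] at hs
      rw [← mul_one (Dg g0), hs, mul_zero]
    | 1, hs, _ => exact absurd (by simpa using hs) hD0
    | k + 2, hs, hmin => exact ⟨k, hmin (k + 1) (by omega), hs⟩
  obtain ⟨y0, hy0⟩ : ∃ y0, (Dg g0 ^ (k + 1)) y0 ≠ 0 := by
    by_contra hno
    push Not at hno
    exact hk1 (LinearMap.ext hno)
  set e := (Dg g0 ^ (k + 1)) y0 with he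
  have hker : ∀ y, Dg g0 ((Dg g0 ^ (k + 1)) y) = 0 := by
    intro y
    rw [← Module.End.mul_apply, ← pow_succ', hk2]; rfl
  have horth : ∀ u, Dg g0 u = 0 → ∀ y, lorB m u ((Dg g0 ^ (k + 1)) y) = 0 := by
    intro u hu y
    rw [pow_succ', Module.End.mul_apply]
    exact perp_fixed hG (hA hg0) hu _
  have heQ : lorentzQ m e = 0 := by rw [← lorB_self]; exact horth e (hker y0) y0
  have him : ∀ y, ∃ c : ℝ, (Dg g0 ^ (k + 1)) y = c • e := by
    intro y
    refine (lor_perp_null heQ hy0 (horth _ (hker y) y0)).2 ?_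
    rw [← lorB_self]; exact horth _ (hker y) y
  have hfixA : ∀ h ∈ A, h.linear e = e := by
    intro h hh
    have h1 : h.linear e = (Dg g0 ^ (k + 1)) (h.linear y0) :=
      (Dg_semiconj (hcomm g0 hg0 h hh) (k + 1) y0).symm
    obtain ⟨c, hc⟩ := him (h.linear y0)
    rw [← h1] at hc
    have h2 : ∀ j : ℕ, (Dg h ^ j) e = (c - 1) ^ j • e := by
      intro j
      induction j with
      | zero => simp
      | succ j ih =>
        rw [pow_succ', Module.End.mul_apply, ih, map_smul, Dg_apply, hc, pow_succ, mul_smul, sub_smul,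
          one_smul]
    have h3 := h2 (m + 2)
    rw [hnil h hh] at h3
    have h4 : (c - 1) ^ (m + 2) = 0 := by
      rcases smul_eq_zero.1 h3.symm with h | h
      · exact h
      · exact absurd h hy0
    have h5 : c = 1 := by
      have := pow_eq_zero_iff (by omega : m + 2 ≠ 0) |>.1 h4
      linarith
    rw [hc, h5, one_smul]
  have hfixG : ∀ η ∈ Γ, ∃ α : ℝ, 0 < α ∧ η.linear e = α • e := by
    intro η hη
    have hg' : η⁻¹ * g0 * η ∈ A := by
      have := hnorm η⁻¹ (Γ.inv_mem hη) g0 hg0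
      rwa [inv_inv] at this
    have h1 : g0 * η = η * (η⁻¹ * g0 * η) := by group
    have h2 : Dg g0 (η.linear e) = 0 := by
      have := Dg_semiconj h1 1 e
      rw [pow_one, pow_one] at this
      rw [this, Dg_apply, hfixA _ hg', sub_self, map_zero]
    obtain ⟨α, hα⟩ := (lor_perp_null heQ hy0 (horth _ h2 y0)).2 (by rw [step1 hG hη, heQ])
    refine ⟨α, ?_, hα⟩
    have h3 := isoB hG hη e (tvec m)
    rw [hα, map_smul, LinearMap.smul_apply, smul_eq_mul] at h3
    have h4 := null_sign heQ hy0 (tvec_mem m) (hG.fut η hη _ (tvec_mem m))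
    rw [← h3, mul_assoc] at h4
    exact pos_of_mul_pos_left h4 (mul_self_nonneg _)
  obtain ⟨y, hy⟩ : ∃ y, lorB m e y ≠ 0 := by
    by_contra hno
    push Not at hno
    exact hy0 (lorB_nondeg e hno)
  obtain ⟨y', hy'e⟩ : ∃ y', lorB m y' e = 1 := by
    refine ⟨(lorB m e y)⁻¹ • y, ?_⟩
    simp only [map_smul, LinearMap.smul_apply, smul_eq_mul]
    rw [lorB_comm m y e]
    exact inv_mul_cancel₀ hy
  refine ⟨A, e, y' - (lorentzQ m y' / 2) • e, ⟨hG, hA, hcomm, hnorm, hy0, heQ, ?_, ?_, hfixA, hfixG, ?_⟩,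
    g0, hg0, hg01⟩
  · rw [lorQ_sub, lorQ_smul, heQ, map_smul, smul_eq_mul, hy'e]; ring
  · rw [map_sub, LinearMap.sub_apply, hy'e, map_smul, LinearMap.smul_apply, lorB_self, heQ]; simp
  · intro h hh w hw
    exact perp_aux hG (hA hh) hy0 heQ (hfixA h hh) (hnil h hh) w hw

end Step4


noncomputable section Step5

namespace Frame

variable {m : ℕ} {Γ A : Subgroup (AffGroup (m + 2))} {e f : Vec (m + 2)}

lemma ve (F : Frame m Γ A e f) {g : AffGroup (m + 2)} (hg : g ∈ A) (x : Vec (m + 2)) :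
    lorB m (Dg g x) e = 0 := by
  rw [lorB_comm]
  exact perp_fixed F.good (F.le hg) (by rw [Dg_apply, F.fixA g hg, sub_self]) x

lemma vf (F : Frame m Γ A e f) {g : AffGroup (m + 2)} (hg : g ∈ A) :
    lorB m (Dg g f) f = -lorentzQ m (Dg g f) / 2 := by
  have h1 := step1 F.good (F.le hg) f
  have h2 : g.linear f = f + Dg g f := by rw [Dg_apply]; abel
  rw [h2, lorQ_add, F.fQ, lorB_comm] at h1
  linarith

lemma formula (F : Frame m Γ A e f) {g : AffGroup (m + 2)} (hg : g ∈ A) (x : Vec (m + 2)) :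
    Dg g x = lorB m x e • Dg g f - (lorB m (Dg g f) x + lorB m x e * lorentzQ m (Dg g f) / 2) • e := by
  set q := lorB m x e with hq
  have hp : lorB m (x - q • f) e = 0 := by
    rw [map_sub, map_smul, LinearMap.sub_apply, LinearMap.smul_apply, F.fe, ← hq]; simp
  obtain ⟨c, hc⟩ := F.perp g hg _ hp
  have h1 := isoB F.good (F.le hg) f (x - q • f)
  have h2 : g.linear f = f + Dg g f := by rw [Dg_apply]; abel
  have h3 : g.linear (x - q • f) = (x - q • f) + c • e := by rw [← hc, Dg_apply]; abel
  rw [h2, h3] at h1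
  simp only [map_add, LinearMap.add_apply, map_smul, map_sub, smul_eq_mul] at h1 hc
  rw [F.ve hg, F.fe, F.vf hg] at h1
  have h4 : c = -(lorB m (Dg g f) x + q * lorentzQ m (Dg g f) / 2) := by linarith
  rw [sub_eq_iff_eq_add] at hc
  rw [hc, h4]
  module

lemma vQ (F : Frame m Γ A e f) {g : AffGroup (m + 2)} (hg : g ∈ A) (h1 : g ≠ 1) :
    0 < lorentzQ m (Dg g f) := by
  obtain ⟨h2, h3⟩ := lor_perp_null F.eQ F.e0 (F.ve hg f)
  refine lt_of_le_of_ne h2 fun h4 => h1 ?_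
  obtain ⟨c, hc⟩ := h3 h4.symm
  have h5 := F.vf hg
  rw [← h4, hc, map_smul, LinearMap.smul_apply, lorB_comm, F.fe] at h5
  have hc0 : c = 0 := by simpa using h5
  rw [hc0, zero_smul] at hc
  refine F.good.inj g (F.le hg) fun v => ?_
  have := F.formula hg v
  rw [hc, lorQ_zero] at this
  simp only [smul_zero, map_zero, LinearMap.zero_apply, mul_zero, zero_div, add_zero, zero_smul,
    sub_zero] at this
  exact sub_eq_zero.1 this

lemma cross (F : Frame m Γ A e f) {g h : AffGroup (m + 2)} (hg : g ∈ A) (hh : h ∈ A) :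
    Dg g (h 0) = Dg h (g 0) := by
  have h1 := congrArg (fun k : AffGroup (m + 2) => k 0) (F.comm g hg h hh)
  simp only [aff_mul] at h1
  rw [aff_apply0 g (h 0), aff_apply0 h (g 0)] at h1
  rw [Dg_apply, Dg_apply, sub_eq_sub_iff_add_eq_add, add_comm _ (g 0), h1, add_comm (h 0)]

lemma Qadd_e (F : Frame m Γ A e f) (v : Vec (m + 2)) (hv : lorB m v e = 0) (c : ℝ) :
    lorentzQ m (v + c • e) = lorentzQ m v := by
  rw [lorQ_add, lorQ_smul, F.eQ, map_smul, hv]; simp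

lemma q_lin (F : Frame m Γ A e f) {η : AffGroup (m + 2)} (hη : η ∈ Γ) {α : ℝ} (hα : 0 < α)
    (h : η.linear e = α • e) (x : Vec (m + 2)) : lorB m (η.linear x) e = α⁻¹ * lorB m x e := by
  have h1 := isoB F.good hη x e
  rw [h, map_smul, smul_eq_mul] at h1
  rw [← h1]; field_simp

lemma conj_diff {n : ℕ} (η g : AffGroup n) (x : Vec n) :
    (η * g * η⁻¹) (η x) - η x = η.linear (g x - x) := by
  rw [← aff_sub, aff_mul, aff_mul, aff_inv']

lemma conj_lin {n : ℕ} (η g : AffGroup n) (x : Vec n) :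
    Dg (η * g * η⁻¹) (η.linear x) = η.linear (Dg g x) := by
  have := Dg_semiconj (η := η) (g := η * g * η⁻¹) (g' := g) (by group) 1 x
  simpa using this

lemma diff_eq {n : ℕ} (g : AffGroup n) (x : Vec n) : g x - x = g 0 + Dg g x := by
  rw [aff_apply0, Dg_apply]; abel

lemma q_trans (F : Frame m Γ A e f) {η : AffGroup (m + 2)} (hη : η ∈ Γ) {α : ℝ} (hα : 0 < α)
    (h : η.linear e = α • e) {g : AffGroup (m + 2)} (hg : g ∈ A) :
    lorB m ((η * g * η⁻¹) 0) e = α⁻¹ * lorB m (g 0) e := by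
  have h1 := congrArg (fun x => lorB m x e) (conj_diff η g 0)
  rw [F.q_lin hη hα h, diff_eq, map_add, LinearMap.add_apply, F.ve (F.norm η hη g hg), add_zero,
    sub_zero] at h1
  exact h1

lemma quad_unbounded (a b c M : ℝ) (ha : 0 < a) (h : ∀ s : ℝ, c + s * b + s ^ 2 * a ≤ M) : False := by
  have h1 := h (1 + (|b| + |c| + |M|) / a)
  set k := (|b| + |c| + |M|) / a with hk
  have hk0 : 0 ≤ k := by positivity
  have hka : k * a = |b| + |c| + |M| := by rw [hk]; field_simp
  have e : c + (1 + k) * b + (1 + k) ^ 2 * a = c + (1 + k) * (a + (b + |b|) + |c| + |M|) := by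
    rw [show (1 + k) ^ 2 * a = (1 + k) * (a + k * a) by ring, hka]; ring
  rw [e] at h1
  have h2 : 0 ≤ b + |b| := by linarith [neg_abs_le b]
  have h3 : a + (b + |b|) + |c| + |M| ≤ (1 + k) * (a + (b + |b|) + |c| + |M|) := by
    have : 0 ≤ a + (b + |b|) + |c| + |M| := by positivity
    nlinarith
  linarith [neg_abs_le c, le_abs_self M]

/-- Case I -/
lemma caseI (F : Frame m Γ A e f) {g : AffGroup (m + 2)} (hg : g ∈ A) (hq : lorB m (g 0) e ≠ 0) :
    False := by
  have hg1 : g ≠ 1 := by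
    rintro rfl
    apply hq
    have : (1 : AffGroup (m + 2)) 0 = 0 := rfl
    rw [this]; simp
  have hQ := F.vQ hg hg1
  have hcen : ∀ η ∈ Γ, η * g * η⁻¹ = g := by
    intro η hη
    obtain ⟨α, hα, hηe⟩ := F.fixG η hη
    have hg' := F.norm η hη g hg
    have hqt := F.q_trans hη hα hηe hg
    set g' := η * g * η⁻¹ with hg'def
    set v := Dg g f with hv
    set v' := Dg g' f with hv'
    set qg := lorB m (g 0) e with hqg
    obtain ⟨c, hc⟩ : ∃ c : ℝ, v' = α⁻¹ • v + c • e := by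
      have h1 := F.cross hg hg'
      rw [F.formula hg, F.formula hg', hqt, ← hqg, ← hv, ← hv'] at h1
      set r1 := lorB m v (g' 0) + α⁻¹ * qg * lorentzQ m v / 2
      set r2 := lorB m v' (g 0) + qg * lorentzQ m v' / 2
      refine ⟨qg⁻¹ * (r2 - r1), ?_⟩
      have h2 : qg • v' = (α⁻¹ * qg) • v + (r2 - r1) • e := by
        rw [sub_eq_iff_eq_add] at h1
        rw [h1]; module
      rw [← inv_smul_smul₀ hq v', h2, smul_add, smul_smul, smul_smul]
      congr 2
      field_simp
    have hve : lorB m v e = 0 := F.ve hg f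
    have hve' : lorB m v' e = 0 := F.ve hg' f
    have hQ1 : lorentzQ m v' = (α⁻¹) ^ 2 * lorentzQ m v := by
      rw [hc, F.Qadd_e _ (by rw [map_smul, LinearMap.smul_apply, hve, smul_zero]), lorQ_smul]
    have hQ2 : lorentzQ m v = (α⁻¹) ^ 2 * lorentzQ m v' := by
      have h1 := conj_lin η g f
      rw [← hg'def, F.formula hg', F.q_lin hη hα hηe, F.fe, mul_one, ← hv, ← hv'] at h1
      have h2 := congrArg (lorentzQ m) h1
      rw [step1 F.good hη, sub_eq_add_neg, ← neg_smul,
        F.Qadd_e _ (by rw [map_smul, LinearMap.smul_apply, hve', smul_zero]), lorQ_smul] at h2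
      exact h2.symm
    have hα1 : α⁻¹ = 1 := by
      have hp : 0 < α⁻¹ := inv_pos.2 hα
      have h3 : (α⁻¹) ^ 4 = 1 := by
        have : lorentzQ m v * ((α⁻¹) ^ 4 - 1) = 0 := by
          rw [hQ1] at hQ2
          linear_combination -hQ2
        rcases mul_eq_zero.1 this with h | h
        · exact absurd h hQ.ne'
        · linarith
      exact (pow_eq_one_iff_of_nonneg hp.le (by norm_num)).1 h3
    rw [hα1] at hc hQ1
    rw [one_smul] at hc
    have hf1 := F.vf hg
    have hf2 := F.vf hg'
    rw [← hv] at hf1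
    rw [← hv', hQ1, hc, map_add, LinearMap.add_apply, hf1, map_smul, LinearMap.smul_apply, lorB_comm m e f,
      F.fe, smul_eq_mul] at hf2
    have hc0 : c = 0 := by linarith
    rw [hc0, zero_smul, add_zero] at hc
    have hD : ∀ x, Dg g' x = Dg g x := by
      intro x
      rw [F.formula hg, F.formula hg', ← hv, ← hv', hc]
    have h6 : g⁻¹ * g' = 1 := by
      refine F.good.inj _ (Γ.mul_mem (Γ.inv_mem (F.le hg)) (F.le hg')) fun x => ?_
      have h7 := hD x
      rw [Dg_apply, Dg_apply, sub_left_inj] at h7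
      rw [aff_mul_linear, h7, aff_inv_linear']
    exact (inv_mul_eq_one.1 h6).symm
  have hinv : ∀ η ∈ Γ, ∀ x, lorentzQ m (g (η x) - η x) = lorentzQ m (g x - x) := by
    intro η hη x
    have := conj_diff η g x
    rw [hcen η hη] at this
    rw [this, step1 F.good hη]
  obtain ⟨K, hK, hKc⟩ := F.good.cc
  have hcont : Continuous fun x => lorentzQ m (g x - x) :=
    (lorQ_continuous m).comp ((affEquiv_continuous g).sub continuous_id)
  obtain ⟨M, hM⟩ := hK.bddAbove_image hcont.continuousOn
  refine quad_unbounded (lorentzQ m (Dg g f)) (2 * lorB m (g 0) (Dg g f)) (lorentzQ m (g 0)) M hQ fun s => ?_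
  obtain ⟨γ, hγ, hx⟩ := hKc (s • f)
  have h1 : lorentzQ m (g (γ (s • f)) - γ (s • f)) ≤ M := hM ⟨_, hx, rfl⟩
  rw [hinv γ hγ, diff_eq, map_smul, lorQ_add, lorQ_smul, map_smul, smul_eq_mul] at h1
  linarith

lemma lorB_bound (m : ℕ) : ∃ C : ℝ, 0 ≤ C ∧ ∀ x y : Vec (m + 2), |lorB m x y| ≤ C * ‖x‖ * ‖y‖ := by
  refine ⟨(m + 1) + 1, by positivity, fun x y => ?_⟩
  have h : ∀ i, |x i * y i| ≤ ‖x‖ * ‖y‖ := by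
    intro i
    rw [abs_mul]
    exact mul_le_mul (norm_le_pi_norm x i) (norm_le_pi_norm y i) (abs_nonneg _) (norm_nonneg _)
  rw [lorB_apply]
  calc _ ≤ |∑ i : Fin (m + 1), x i.castSucc * y i.castSucc| + |x (Fin.last (m+1)) * y (Fin.last (m+1))| :=
        abs_sub _ _
    _ ≤ (∑ i : Fin (m + 1), ‖x‖ * ‖y‖) + ‖x‖ * ‖y‖ := by
        refine add_le_add ((Finset.abs_sum_le_sum_abs _ _).trans (Finset.sum_le_sum fun i _ => h _)) (h _)
    _ = ((m + 1) + 1) * ‖x‖ * ‖y‖ := by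
        rw [Finset.sum_const, Finset.card_univ, Fintype.card_fin, nsmul_eq_mul]; push_cast; ring

/-- quadratic bound from symmetric pairs -/
lemma pair_bound (m : ℕ) (S : Set (Vec (m + 2) × Vec (m + 2)))
    (hS : ∀ p ∈ S, ∀ p' ∈ S, lorB m p.1 p'.2 = lorB m p'.1 p.2) :
    ∃ C : ℝ, 0 ≤ C ∧ ∀ p ∈ S, |lorB m p.1 p.2| ≤ C * ‖p.1‖ ^ 2 := by
  let W := Submodule.span ℝ S
  have hW : ∀ p ∈ W, ∀ p' ∈ W, lorB m p.1 p'.2 = lorB m p'.1 p.2 := by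
    intro p hp p' hp'
    induction hp, hp' using Submodule.span_induction₂ with
    | mem_mem x y hx hy => exact hS x hx y hy
    | zero_left y hy => simp
    | zero_right x hx => simp
    | add_left x y z hx hy hz h1 h2 => simp [h1, h2]
    | add_right x y z hx hy hz h1 h2 => simp [h1, h2]
    | smul_left r x y hx hy h => simp [h]
    | smul_right r x y hx hy h => simp [h]
  let pr : W →ₗ[ℝ] Vec (m + 2) := (LinearMap.fst ℝ (Vec (m+2)) (Vec (m+2))).comp W.subtype
  obtain ⟨s, hs⟩ := LinearMap.exists_rightInverse_of_surjective pr.rangeRestrict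
    (LinearMap.range_eq_top.2 pr.surjective_rangeRestrict)
  let t : LinearMap.range pr →ₗ[ℝ] Vec (m + 2) :=
    ((LinearMap.snd ℝ (Vec (m+2)) (Vec (m+2))).comp W.subtype).comp s
  let t' := LinearMap.toContinuousLinearMap t
  obtain ⟨C, hC, hB⟩ := lorB_bound m
  refine ⟨C * ‖t'‖, by positivity, fun p hp => ?_⟩
  have hpW : p ∈ W := Submodule.subset_span hp
  let u : LinearMap.range pr := pr.rangeRestrict ⟨p, hpW⟩
  have hu : (u : Vec (m + 2)) = p.1 := rfl
  have hsu : ((s u : W) : Vec (m + 2) × Vec (m + 2)).1 = p.1 := by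
    have := congrArg (fun T : LinearMap.range pr →ₗ[ℝ] LinearMap.range pr => ((T u : LinearMap.range pr) : Vec (m + 2))) hs
    exact this
  have h1 := hW p hpW (s u) (s u).2
  rw [hsu] at h1
  rw [← h1]
  have h2 : ((s u : W) : Vec (m + 2) × Vec (m + 2)).2 = t' u := rfl
  rw [h2]
  calc _ ≤ C * ‖p.1‖ * ‖t' u‖ := hB _ _
    _ ≤ C * ‖p.1‖ * (‖t'‖ * ‖p.1‖) := by
        gcongr
        exact t'.le_opNorm u
    _ = _ := by ring

lemma caseII_bound (F : Frame m Γ A e f) (hq : ∀ g ∈ A, lorB m (g 0) e = 0) :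
    ∃ C : ℝ, ∀ g ∈ A, |lorB m (Dg g f) (g 0)| ≤ C * lorentzQ m (Dg g f) := by
  let vt : AffGroup (m + 2) → Vec (m + 2) := fun g => Dg g f - lorB m (Dg g f) f • e
  have hvt : ∀ g, ∀ h ∈ A, lorB m (vt g) (h 0) = lorB m (Dg g f) (h 0) := by
    intro g h hh
    simp only [vt, map_sub, map_smul, LinearMap.sub_apply, LinearMap.smul_apply]
    rw [lorB_comm m e, hq h hh, smul_zero, sub_zero]
  have hsym : ∀ g ∈ A, ∀ h ∈ A, lorB m (Dg g f) (h 0) = lorB m (Dg h f) (g 0) := by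
    intro g hg h hh
    have h1 := F.cross hg hh
    rw [F.formula hg, F.formula hh, hq g hg, hq h hh] at h1
    simp only [zero_smul, zero_mul, zero_div, add_zero, zero_sub, neg_inj] at h1
    exact smul_left_injective ℝ F.e0 h1
  obtain ⟨C, hC, hCb⟩ := pair_bound m ((fun g => (vt g, g 0)) '' (A : Set (AffGroup (m + 2)))) (by
    rintro _ ⟨g, hg, rfl⟩ _ ⟨h, hh, rfl⟩
    simp only
    rw [hvt g h hh, hvt h g hg, hsym g hg h hh])
  have hτQ : lorentzQ m (e - f) < 0 := by
    rw [lorQ_sub, F.eQ, F.fQ, lorB_comm, F.fe]; norm_num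
  obtain ⟨k, C', hk, -, hb⟩ := nform_bounds {e - f} isCompact_singleton (by simpa using hτQ)
  refine ⟨C / k, fun g hg => ?_⟩
  have h1 := hCb _ ⟨g, hg, rfl⟩
  simp only at h1
  rw [hvt g g hg] at h1
  have h2 := (hb _ rfl (vt g)).1
  have h3 : lorB m (vt g) (e - f) = 0 := by
    simp only [vt, map_sub, map_smul, LinearMap.sub_apply, LinearMap.smul_apply]
    rw [F.ve hg, lorB_self, F.eQ, lorB_comm m e f, F.fe]; simp
  have h4 : lorentzQ m (vt g) = lorentzQ m (Dg g f) := by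
    simp only [vt]
    rw [sub_eq_add_neg, ← neg_smul, F.Qadd_e _ (F.ve hg f)]
  rw [nform, h3, h4] at h2
  have h5 : ‖vt g‖ ^ 2 ≤ lorentzQ m (Dg g f) / k := by
    rw [le_div_iff₀ hk]
    simp at h2
    linarith
  calc _ ≤ C * ‖vt g‖ ^ 2 := h1
    _ ≤ C * (lorentzQ m (Dg g f) / k) := by gcongr
    _ = _ := by ring

lemma caseII (F : Frame m Γ A e f) (hq : ∀ g ∈ A, lorB m (g 0) e = 0) (hne : ∃ g ∈ A, g ≠ 1) :
    False := by
  obtain ⟨C, hC⟩ := F.caseII_bound hq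
  let vx : AffGroup (m + 2) → ℝ := fun g => -lorB m (Dg g f) (g 0) / lorentzQ m (Dg g f)
  let S : Set ℝ := vx '' {g | g ∈ A ∧ g ≠ 1}
  have hSne : S.Nonempty := by
    obtain ⟨g, hg, h1⟩ := hne
    exact ⟨_, g, ⟨hg, h1⟩, rfl⟩
  have hSb : BddAbove S := by
    refine ⟨C, ?_⟩
    rintro _ ⟨g, ⟨hg, h1⟩, rfl⟩
    have h2 := F.vQ hg h1
    simp only [vx]
    rw [div_le_iff₀ h2]
    exact (neg_le_abs _).trans (hC g hg)
  have hP : ∀ g ∈ A, ∀ x, lorentzQ m (g x - x) = lorentzQ m (g 0)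
      + 2 * lorB m x e * lorB m (Dg g f) (g 0) + lorB m x e ^ 2 * lorentzQ m (Dg g f) := by
    intro g hg x
    rw [diff_eq, F.formula hg, sub_eq_add_neg, ← neg_smul, ← add_assoc, F.Qadd_e, lorQ_add, lorQ_smul,
      map_smul, smul_eq_mul, lorB_comm m (g 0)]
    · ring
    · rw [map_add, LinearMap.add_apply, hq g hg, map_smul, LinearMap.smul_apply, F.ve hg]; simp
  have hqη : ∀ η ∈ Γ, ∀ α : ℝ, 0 < α → η.linear e = α • e → ∀ x,
      lorB m (η x) e = α⁻¹ * lorB m x e + lorB m (η 0) e := by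
    intro η hη α hα h x
    rw [aff_apply0, map_add, LinearMap.add_apply, F.q_lin hη hα h]; ring
  have hmap : ∀ η ∈ Γ, ∀ α : ℝ, 0 < α → η.linear e = α • e → ∀ r ∈ S,
      α⁻¹ * r + lorB m (η 0) e ∈ S := by
    rintro η hη α hα hηe _ ⟨g, ⟨hg, h1⟩, rfl⟩
    have hg' := F.norm η hη g hg
    have hg1' : η * g * η⁻¹ ≠ 1 := by
      intro h
      apply h1
      simpa using h
    refine ⟨η * g * η⁻¹, ⟨hg', hg1'⟩, ?_⟩
    have hQ := F.vQ hg h1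
    have hQ' := F.vQ hg' hg1'
    have key : ∀ s : ℝ, lorentzQ m ((η * g * η⁻¹) (η (s • f)) - η (s • f)) =
        lorentzQ m (g (s • f) - s • f) := by
      intro s
      rw [conj_diff, step1 F.good hη]
    have hqs := fun s : ℝ => hqη η hη α hα hηe (s • f)
    simp only [hP _ hg', hP _ hg, hqs] at key
    simp only [vx]
    set g' := η * g * η⁻¹
    set a := lorentzQ m (Dg g f)
    set a' := lorentzQ m (Dg g' f)
    set b := lorB m (Dg g f) (g 0)
    set b' := lorB m (Dg g' f) (g' 0)
    set c := lorB m (η 0) e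
    set β := α⁻¹ with hβ
    have hβp : 0 < β := inv_pos.2 hα
    simp only [map_smul, LinearMap.smul_apply, F.fe, smul_eq_mul, mul_one] at key
    have k0 := key 0
    have k1 := key 1
    have k2 := key (-1)
    have e1 : β ^ 2 * a' = a := by linear_combination (k1 + k2) / 2 - k0
    have e2 : β * (a' * c + b') = b := by linear_combination (k1 - k2) / 4
    rw [← e2, ← e1]
    field_simp
    ring
  have hconv : Convex ℝ {x : Vec (m + 2) | lorB m x e ≤ sSup S} := by
    have := convex_halfSpace_le (𝕜 := ℝ) (f := fun x => lorB m x e)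
      ⟨fun x y => by simp, fun c x => by simp⟩ (sSup S)
    exact this
  have hfe : ∀ r : ℝ, lorB m (r • f) e = r := by
    intro r; rw [map_smul, LinearMap.smul_apply, F.fe]; simp
  have huniv := INV Γ F.good.pd F.good.cc _ hconv ⟨sSup S • f, by rw [Set.mem_ofPred_eq, hfe]⟩ (by
    intro η hη x hx
    obtain ⟨α, hα, hηe⟩ := F.fixG η hη
    rw [Set.mem_ofPred_eq] at hx ⊢
    rw [hqη η hη α hα hηe]
    have h1 : sSup S ≤ α * (sSup S - lorB m (η 0) e) := by
      refine csSup_le hSne fun r hr => ?_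
      have h2 := le_csSup hSb (hmap η hη α hα hηe r hr)
      have h3 : α⁻¹ * r ≤ sSup S - lorB m (η 0) e := by linarith
      rwa [inv_mul_le_iff₀ hα] at h3
    have h4 : α⁻¹ * lorB m x e ≤ sSup S - lorB m (η 0) e := by
      rw [inv_mul_le_iff₀ hα]; exact hx.trans h1
    linarith)
  have : (sSup S + 1) • f ∈ {x : Vec (m + 2) | lorB m x e ≤ sSup S} := by rw [huniv]; trivial
  rw [Set.mem_ofPred_eq, hfe] at this
  linarith

end Frame

lemma good_false {m : ℕ} {Γ : Subgroup (AffGroup (m + 2))} (hG : Good m Γ) : False := by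
  obtain ⟨A, e, f, F, hne⟩ := exists_frame hG
  by_cases h : ∀ g ∈ A, lorB m (g 0) e = 0
  · exact F.caseII h hne
  · push Not at h
    obtain ⟨g, hg, hq⟩ := h
    exact F.caseI hg hq

end Step5

theorem statement3 (m : ℕ) (Γ : Subgroup (AffGroup (m + 2)))
    (hSim : ∀ γ ∈ Γ, InSimL m γ)
    (hFree : FreeAction Γ) (hPD : ProperlyDisc Γ) (hCC : CocompactAction Γ) :
    ∃ γ ∈ Γ, γ ≠ 1 ∧ ∃ a : Vec (m + 2), a ≠ 0 ∧ ∀ x : Vec (m + 2), γ x = x + a := by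
  by_contra hno
  obtain ⟨Γ', hG⟩ := exists_good m Γ hSim hFree hPD hCC (by
    intro γ hγ hlin
    by_contra h1
    refine hno ⟨γ, hγ, h1, γ 0, fun h0 => h1 (hFree γ hγ ⟨0, h0⟩), fun x => ?_⟩
    rw [aff_apply0, hlin]; exact add_comm _ _)
  exact good_false hG
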